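/- arXiv:1509.00987 — 3 statements merged into one kernel-verified Lean document; each statement's English description precedes it below -/
import Mathlib

section
/- Let n ≥ 1 and N ≥ 1 be integers, and let μ be a Borel measure on ℂ^N for which there are constants C₀ > 0 and R > 0 with μ(B_ρ(w)) ≤ C₀ ρ^{2n} for every w ∈ ℂ^N and every 0 < ρ ≤ R. Let D ⊆ ℂ^N be a bounded Borel set and let 0 ≤ α < 2n and 0 ≤ β < 2n. Then there exists a constant C₂ > 0, depending only on n, N, C₀, R, α, β and the diameter of D, such that for all z, w ∈ ℂ^N with z ≠ w one has: ∫_D dμ(ζ) / ( ‖ζ − z‖^α ‖ζ − w‖^β ) ≤ C₂ if α + β < 2n; ≤ C₂ · (1 + |log ‖z − w‖|) if α + β = 2n; and ≤ C₂ · ‖z − w‖^{2n − α − β} if α + β > 2n. -/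
open MeasureTheory Metric
open scoped NNReal ENNReal

theorem setLIntegral_biUnion_finset_le {X ι : Type*} [MeasurableSpace X] {ν : Measure X}
    (t : Finset ι) (s : ι → Set X) (f : X → ℝ≥0∞) :
    ∫⁻ x in ⋃ i ∈ t, s i, f x ∂ν ≤ ∑ i ∈ t, ∫⁻ x in s i, f x ∂ν := by
  classical
  induction t using Finset.induction_on with
  | empty => simp
  | insert i t hi ih =>
    rw [Finset.set_biUnion_insert, Finset.sum_insert hi]
    exact (lintegral_union_le _ _ _).trans (by gcongr)

theorem measure_singleton_of_ball_le {X : Type*} [MetricSpace X] [MeasurableSpace X]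
    {ν : Measure X} {C m : ℝ} (hm : 0 < m)
    (h : ∀ z ρ, 0 < ρ → ν (ball z ρ) ≤ ENNReal.ofReal (C * ρ ^ m)) (z : X) : ν {z} = 0 := by
  have hlim : Filter.Tendsto (fun ρ : ℝ ↦ ENNReal.ofReal (C * ρ ^ m))
      (nhdsWithin 0 (Set.Ioi 0)) (nhds 0) := by
    have : Filter.Tendsto (fun ρ : ℝ ↦ ENNReal.ofReal (C * ρ ^ m)) (nhds 0)
        (nhds (ENNReal.ofReal (C * 0 ^ m))) :=
      (ENNReal.continuous_ofReal.comp
        (continuous_const.mul (Real.continuous_rpow_const hm.le))).tendsto 0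
    simp only [Real.zero_rpow hm.ne', mul_zero, ENNReal.ofReal_zero] at this
    exact this.mono_left nhdsWithin_le_nhds
  refine le_antisymm (ge_of_tendsto hlim ?_) zero_le
  filter_upwards [self_mem_nhdsWithin] with ρ hρ
  exact (measure_mono (by simpa using hρ)).trans (h z ρ hρ)

section PowerIntegrals

variable {X : Type*} [MetricSpace X] [MeasurableSpace X] [OpensMeasurableSpace X]
  {ν : Measure X} {C m M : ℝ}

theorem lintegral_shell_le (h : ∀ z ρ, 0 < ρ → ν (ball z ρ) ≤ ENNReal.ofReal (C * ρ ^ m))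
    {s ρ : ℝ} (hs : 0 ≤ s) (hρ : 0 < ρ) (z : X) :
    ∫⁻ ζ in {ζ | ρ ≤ dist ζ z ∧ dist ζ z ≤ 2 * ρ}, ENNReal.ofReal (dist ζ z ^ (-s)) ∂ν ≤
      ENNReal.ofReal (C * 4 ^ m * ρ ^ (m - s)) := by
  have hmeas : MeasurableSet {ζ | ρ ≤ dist ζ z ∧ dist ζ z ≤ 2 * ρ} :=
    ((isClosed_Icc (a := ρ) (b := 2 * ρ)).preimage
      (continuous_id.dist continuous_const)).measurableSet
  calc _ ≤ ∫⁻ _ in {ζ | ρ ≤ dist ζ z ∧ dist ζ z ≤ 2 * ρ}, ENNReal.ofReal (ρ ^ (-s)) ∂ν :=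
        setLIntegral_mono' hmeas fun ζ hζ ↦ ENNReal.ofReal_le_ofReal
          (Real.rpow_le_rpow_of_nonpos hρ hζ.1 (by linarith))
    _ ≤ ENNReal.ofReal (ρ ^ (-s)) * ENNReal.ofReal (C * (4 * ρ) ^ m) := by
        rw [setLIntegral_const]
        gcongr
        refine (measure_mono fun ζ hζ ↦ ?_).trans (h z (4 * ρ) (by positivity))
        have := hζ.2
        simp only [mem_ball]
        linarith
    _ = _ := by
        rw [← ENNReal.ofReal_mul (by positivity), Real.mul_rpow (by norm_num) hρ.le,
          sub_eq_neg_add, Real.rpow_add hρ]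
        ring_nf

/-- Summing a geometric family of shell bounds. -/
theorem tsum_shell_le (hC : 0 ≤ C) {r t q : ℝ} (hr : 0 < r) (hq : 0 ≤ q) (hq1 : q < 1) :
    ∑' k : ℕ, ENNReal.ofReal (C * 4 ^ m * (r ^ t * q ^ k)) =
      ENNReal.ofReal (C * 4 ^ m / (1 - q) * r ^ t) := by
  have hsum := ((hasSum_geometric_of_lt_one hq hq1).mul_left (r ^ t)).mul_left (C * 4 ^ m)
  rw [← ENNReal.ofReal_tsum_of_nonneg (fun k ↦ by positivity) hsum.summable, hsum.tsum_eq]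
  ring_nf

theorem lintegral_compl_ball_le (hC : 0 ≤ C)
    (h : ∀ z ρ, 0 < ρ → ν (ball z ρ) ≤ ENNReal.ofReal (C * ρ ^ m))
    {s r : ℝ} (hs : 0 ≤ s) (hms : m < s) (hr : 0 < r) (z : X) :
    ∫⁻ ζ in {ζ | r ≤ dist ζ z}, ENNReal.ofReal (dist ζ z ^ (-s)) ∂ν ≤
      ENNReal.ofReal (C * 4 ^ m / (1 - 2 ^ (m - s)) * r ^ (m - s)) := by
  have hcover : {ζ | r ≤ dist ζ z} ⊆
      ⋃ k : ℕ, {ζ | r * 2 ^ k ≤ dist ζ z ∧ dist ζ z ≤ 2 * (r * 2 ^ k)} := by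
    intro ζ hζ
    obtain ⟨k, hk, hk'⟩ := exists_nat_pow_near ((one_le_div hr).2 hζ) one_lt_two
    rw [le_div_iff₀ hr] at hk
    rw [div_lt_iff₀ hr, pow_succ] at hk'
    exact Set.mem_iUnion.2 ⟨k, by linarith, by linarith⟩
  calc _ ≤ _ := lintegral_mono_set hcover
    _ ≤ _ := lintegral_iUnion_le _ _
    _ ≤ ∑' k : ℕ, ENNReal.ofReal (C * 4 ^ m * (r ^ (m - s) * (2 ^ (m - s)) ^ k)) := by
        refine ENNReal.tsum_le_tsum fun k ↦ ?_
        refine (lintegral_shell_le h hs (by positivity) z).trans_eq ?_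
        rw [Real.mul_rpow hr.le (by positivity), ← Real.rpow_pow_comm (by norm_num)]
    _ = _ := tsum_shell_le hC hr (by positivity)
        (Real.rpow_lt_one_of_one_lt_of_neg one_lt_two (by linarith))

theorem lintegral_ball_le (hC : 0 ≤ C) (hm : 0 < m)
    (h : ∀ z ρ, 0 < ρ → ν (ball z ρ) ≤ ENNReal.ofReal (C * ρ ^ m))
    {s r : ℝ} (hs : 0 ≤ s) (hms : s < m) (hr : 0 < r) (z : X) :
    ∫⁻ ζ in ball z r, ENNReal.ofReal (dist ζ z ^ (-s)) ∂ν ≤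
      ENNReal.ofReal (C * 4 ^ m / (1 - 2 ^ (s - m)) * r ^ (m - s)) := by
  have hcover : ball z r \ {z} ⊆
      ⋃ k : ℕ, {ζ | r * 2⁻¹ ^ (k + 1) ≤ dist ζ z ∧ dist ζ z ≤ 2 * (r * 2⁻¹ ^ (k + 1))} := by
    rintro ζ ⟨hζ, hne⟩
    have hpos : 0 < dist ζ z := dist_pos.2 hne
    obtain ⟨k, hk, hk'⟩ := exists_nat_pow_near_of_lt_one (div_pos hpos hr)
      ((div_le_one hr).2 (mem_ball.1 hζ).le) (show (0 : ℝ) < 2⁻¹ by norm_num) (by norm_num)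
    rw [lt_div_iff₀ hr] at hk
    rw [div_le_iff₀ hr] at hk'
    refine Set.mem_iUnion.2 ⟨k, by linarith, ?_⟩
    rw [pow_succ]
    linarith
  have hae : (ball z r \ {z} : Set X) =ᵐ[ν] ball z r :=
    sdiff_null_ae_eq_self (measure_singleton_of_ball_le hm h z)
  have hq : (2 : ℝ) ^ (s - m) < 1 := Real.rpow_lt_one_of_one_lt_of_neg one_lt_two (by linarith)
  rw [← setLIntegral_congr hae]
  calc _ ≤ _ := lintegral_mono_set hcover
    _ ≤ _ := lintegral_iUnion_le _ _
    _ ≤ ∑' k : ℕ, ENNReal.ofReal (C * 4 ^ m * (r ^ (m - s) * (2 ^ (s - m)) ^ k)) := by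
        refine ENNReal.tsum_le_tsum fun k ↦ ?_
        refine (lintegral_shell_le h hs (by positivity) z).trans (ENNReal.ofReal_le_ofReal ?_)
        rw [Real.mul_rpow hr.le (by positivity), ← Real.rpow_pow_comm (by norm_num),
          Real.inv_rpow (by norm_num), ← Real.rpow_neg (by norm_num), neg_sub]
        gcongr C * 4 ^ m * (r ^ (m - s) * ?_)
        exact pow_le_pow_of_le_one (by positivity) hq.le (Nat.le_succ k)
    _ = _ := tsum_shell_le hC hr (by positivity) hq

theorem setLIntegral_rpow_neg_le (hM : ν Set.univ ≤ ENNReal.ofReal M) {s : ℝ} (hs : 0 ≤ s) (z : X) :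
    ∫⁻ ζ in {ζ | 1 ≤ dist ζ z}, ENNReal.ofReal (dist ζ z ^ (-s)) ∂ν ≤ ENNReal.ofReal M := by
  have hmeas : MeasurableSet {ζ | 1 ≤ dist ζ z} :=
    (isClosed_le continuous_const (by fun_prop)).measurableSet
  calc _ ≤ ∫⁻ _ in {ζ | 1 ≤ dist ζ z}, 1 ∂ν :=
        setLIntegral_mono' hmeas fun ζ hζ ↦ by
          simpa using Real.rpow_le_one_of_one_le_of_nonpos hζ (neg_nonpos.2 hs)
    _ ≤ ν Set.univ := by simpa using measure_mono (Set.subset_univ _)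
    _ ≤ _ := hM

theorem lintegral_compl_ball_le_log (hC : 0 ≤ C) (hm : 0 < m)
    (h : ∀ z ρ, 0 < ρ → ν (ball z ρ) ≤ ENNReal.ofReal (C * ρ ^ m))
    (hM0 : 0 ≤ M) (hM : ν Set.univ ≤ ENNReal.ofReal M) {r : ℝ} (hr : 0 < r) (z : X) :
    ∫⁻ ζ in {ζ | r ≤ dist ζ z}, ENNReal.ofReal (dist ζ z ^ (-m)) ∂ν ≤
      ENNReal.ofReal (C * 4 ^ m * (|Real.log r| / Real.log 2 + 1) + M) := by
  set K : ℕ := ⌊|Real.log r| / Real.log 2⌋₊ + 1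
  have hlog : 0 < Real.log 2 := Real.log_pos one_lt_two
  have hcover : {ζ | r ≤ dist ζ z} ⊆ {ζ | 1 ≤ dist ζ z} ∪
      ⋃ k ∈ Finset.range K, {ζ | r * 2 ^ k ≤ dist ζ z ∧ dist ζ z ≤ 2 * (r * 2 ^ k)} := by
    intro ζ hζ
    rcases le_or_gt 1 (dist ζ z) with h1 | h1
    · exact Or.inl h1
    obtain ⟨k, hk, hk'⟩ := exists_nat_pow_near ((one_le_div hr).2 hζ) one_lt_two
    rw [le_div_iff₀ hr] at hk
    rw [div_lt_iff₀ hr, pow_succ] at hk'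
    refine Or.inr (Set.mem_biUnion (x := k) ?_ ⟨by linarith, by linarith⟩)
    have hlt : 2 ^ k * r < 1 := hk.trans_lt h1
    have hlt' := Real.log_neg (by positivity) hlt
    rw [Real.log_mul (by positivity) hr.ne', Real.log_pow] at hlt'
    have : (k : ℝ) ≤ |Real.log r| / Real.log 2 := by
      rw [le_div_iff₀ hlog]
      linarith [neg_le_abs (Real.log r)]
    simpa [K] using Nat.lt_succ_of_le (Nat.le_floor this)
  have hshell : ∀ k ∈ Finset.range K,
      ∫⁻ ζ in {ζ | r * 2 ^ k ≤ dist ζ z ∧ dist ζ z ≤ 2 * (r * 2 ^ k)},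
        ENNReal.ofReal (dist ζ z ^ (-m)) ∂ν ≤ ENNReal.ofReal (C * 4 ^ m) := fun k _ ↦ by
    simpa using lintegral_shell_le h hm.le (show 0 < r * 2 ^ k by positivity) z
  calc _ ≤ _ := lintegral_mono_set hcover
    _ ≤ _ := lintegral_union_le _ _ _
    _ ≤ ENNReal.ofReal M + ∑ k ∈ Finset.range K, ENNReal.ofReal (C * 4 ^ m) := by
        gcongr
        · exact setLIntegral_rpow_neg_le hM hm.le z
        · exact (setLIntegral_biUnion_finset_le _ _ _).trans (Finset.sum_le_sum hshell)
    _ = ENNReal.ofReal (C * 4 ^ m * K + M) := by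
        rw [← ENNReal.ofReal_sum_of_nonneg (fun _ _ ↦ by positivity),
          ← ENNReal.ofReal_add hM0 (by positivity)]
        simp only [Finset.sum_const, Finset.card_range, nsmul_eq_mul]
        ring_nf
    _ ≤ _ := by
        refine ENNReal.ofReal_le_ofReal ?_
        gcongr
        simpa [K] using Nat.floor_le (by positivity)

theorem one_div_rpow_mul_rpow_le {x y α β : ℝ} (hx : 0 < x) (hy : 0 < y) (hα : 0 ≤ α)
    (hβ : 0 ≤ β) :
    1 / (x ^ α * y ^ β) ≤ x ^ (-(α + β)) ∨ 1 / (x ^ α * y ^ β) ≤ y ^ (-(α + β)) := by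
  rw [Real.rpow_neg hx.le, Real.rpow_neg hy.le, Real.rpow_add hx, Real.rpow_add hy, one_div]
  rcases le_total x y with hxy | hxy
  · left; gcongr
  · right; gcongr

theorem lintegral_two_pole_le_of_lt (hC : 0 ≤ C) (hm : 0 < m)
    (h : ∀ z ρ, 0 < ρ → ν (ball z ρ) ≤ ENNReal.ofReal (C * ρ ^ m))
    (hM0 : 0 ≤ M) (hM : ν Set.univ ≤ ENNReal.ofReal M)
    {α β : ℝ} (hα : 0 ≤ α) (hβ : 0 ≤ β) (hαβ : α + β < m) (z w : X) :
    ∫⁻ ζ, ENNReal.ofReal (1 / (dist ζ z ^ α * dist ζ w ^ β)) ∂ν ≤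
      ENNReal.ofReal (2 * (C * 4 ^ m / (1 - 2 ^ (α + β - m)) + M)) := by
  have hq : (2 : ℝ) ^ (α + β - m) < 1 :=
    Real.rpow_lt_one_of_one_lt_of_neg one_lt_two (by linarith)
  have hpos : 0 ≤ C * 4 ^ m / (1 - 2 ^ (α + β - m)) :=
    div_nonneg (by positivity) (by linarith)
  have one_pole (z : X) : ∫⁻ ζ, ENNReal.ofReal (dist ζ z ^ (-(α + β))) ∂ν ≤
      ENNReal.ofReal (C * 4 ^ m / (1 - 2 ^ (α + β - m)) + M) := by
    have hcover : (Set.univ : Set X) ⊆ ball z 1 ∪ {ζ | 1 ≤ dist ζ z} := fun ζ _ ↦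
      (lt_or_ge (dist ζ z) 1).imp id id
    rw [← setLIntegral_univ, ENNReal.ofReal_add hpos hM0]
    refine (lintegral_mono_set hcover).trans ((lintegral_union_le _ _ _).trans ?_)
    gcongr
    · simpa using lintegral_ball_le hC hm h (by positivity) hαβ one_pos z
    · exact setLIntegral_rpow_neg_le hM (by positivity) z
  have hz : ∀ᵐ ζ ∂ν, ζ ≠ z := by
    simpa [ae_iff] using measure_singleton_of_ball_le hm h z
  have hw : ∀ᵐ ζ ∂ν, ζ ≠ w := by
    simpa [ae_iff] using measure_singleton_of_ball_le hm h w
  calc _ ≤ ∫⁻ ζ, (ENNReal.ofReal (dist ζ z ^ (-(α + β))) +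
          ENNReal.ofReal (dist ζ w ^ (-(α + β)))) ∂ν := by
        refine lintegral_mono_ae ?_
        filter_upwards [hz, hw] with ζ hz hw
        rcases one_div_rpow_mul_rpow_le (dist_pos.2 hz) (dist_pos.2 hw) hα hβ with h | h
        · exact (ENNReal.ofReal_le_ofReal h).trans le_self_add
        · exact (ENNReal.ofReal_le_ofReal h).trans le_add_self
    _ = _ := lintegral_add_left (by fun_prop) _
    _ ≤ _ := add_le_add (one_pole z) (one_pole w)
    _ = _ := by
        rw [← ENNReal.ofReal_add (by positivity) (by positivity), two_mul]

/-- The contribution of a ball around the first pole that stays away from the second one. -/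
theorem lintegral_two_pole_near_le (hC : 0 ≤ C) (hm : 0 < m)
    (h : ∀ z ρ, 0 < ρ → ν (ball z ρ) ≤ ENNReal.ofReal (C * ρ ^ m))
    {α β : ℝ} (hα : 0 ≤ α) (hα' : α < m) (hβ : 0 ≤ β) {r : ℝ} (hr : 0 < r) {z w : X}
    (hzw : 2 * r ≤ dist z w) :
    ∫⁻ ζ in ball z r, ENNReal.ofReal (1 / (dist ζ z ^ α * dist ζ w ^ β)) ∂ν ≤
      ENNReal.ofReal (C * 4 ^ m / (1 - 2 ^ (α - m)) * r ^ (m - (α + β))) := by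
  calc _ ≤ ∫⁻ ζ in ball z r, ENNReal.ofReal (r ^ (-β)) *
          ENNReal.ofReal (dist ζ z ^ (-α)) ∂ν := by
        refine setLIntegral_mono' measurableSet_ball fun ζ hζ ↦ ?_
        have hw : r ≤ dist ζ w := by
          have := dist_triangle_left z w ζ
          linarith [mem_ball.1 hζ]
        rw [← ENNReal.ofReal_mul (by positivity), Real.rpow_neg hr.le,
          Real.rpow_neg dist_nonneg, one_div, mul_inv, mul_comm]
        gcongr
    _ = ENNReal.ofReal (r ^ (-β)) * ∫⁻ ζ in ball z r, ENNReal.ofReal (dist ζ z ^ (-α)) ∂ν :=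
        lintegral_const_mul' _ _ ENNReal.ofReal_ne_top
    _ ≤ _ := by
        grw [lintegral_ball_le hC hm h hα hα' hr z]
        rw [← ENNReal.ofReal_mul (by positivity),
          show m - (α + β) = -β + (m - α) by ring, Real.rpow_add hr]
        ring_nf
        rfl

theorem lintegral_two_pole_le_add (hC : 0 ≤ C) (hm : 0 < m)
    (h : ∀ z ρ, 0 < ρ → ν (ball z ρ) ≤ ENNReal.ofReal (C * ρ ^ m))
    {α β : ℝ} (hα : 0 ≤ α) (hα' : α < m) (hβ : 0 ≤ β) (hβ' : β < m) {r : ℝ} (hr : 0 < r)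
    {z w : X} (hzw : 2 * r ≤ dist z w) {B : ℝ} (hB0 : 0 ≤ B)
    (hB : ∀ z : X, ∫⁻ ζ in {ζ | r ≤ dist ζ z}, ENNReal.ofReal (dist ζ z ^ (-(α + β))) ∂ν ≤
      ENNReal.ofReal B) :
    ∫⁻ ζ, ENNReal.ofReal (1 / (dist ζ z ^ α * dist ζ w ^ β)) ∂ν ≤
      ENNReal.ofReal ((C * 4 ^ m / (1 - 2 ^ (α - m)) + C * 4 ^ m / (1 - 2 ^ (β - m))) *
        r ^ (m - (α + β)) + 2 * B) := by
  set f : X → ℝ≥0∞ := fun ζ ↦ ENNReal.ofReal (1 / (dist ζ z ^ α * dist ζ w ^ β))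
  have hK {a : ℝ} (ha : a < m) : 0 ≤ C * 4 ^ m / (1 - 2 ^ (a - m)) :=
    div_nonneg (by positivity) (sub_nonneg.2
      (Real.rpow_lt_one_of_one_lt_of_neg one_lt_two (by linarith)).le)
  have hKα := hK hα'
  have hKβ := hK hβ'
  have meas (p : X) : MeasurableSet {ζ | r ≤ dist ζ p} :=
    (isClosed_le continuous_const (by fun_prop)).measurableSet
  have hnear : ∫⁻ ζ in ball w r, f ζ ∂ν ≤
      ENNReal.ofReal (C * 4 ^ m / (1 - 2 ^ (β - m)) * r ^ (m - (α + β))) := by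
    have := lintegral_two_pole_near_le hC hm h hβ hβ' hα hr (dist_comm z w ▸ hzw)
    simpa only [f, mul_comm (dist _ z ^ α), add_comm α] using this
  have hfar : ∫⁻ ζ in {ζ | r ≤ dist ζ z} ∩ {ζ | r ≤ dist ζ w}, f ζ ∂ν ≤
      ENNReal.ofReal B + ENNReal.ofReal B := by
    calc _ ≤ ∫⁻ ζ in {ζ | r ≤ dist ζ z} ∩ {ζ | r ≤ dist ζ w},
          (ENNReal.ofReal (dist ζ z ^ (-(α + β))) +
            ENNReal.ofReal (dist ζ w ^ (-(α + β)))) ∂ν := by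
          refine setLIntegral_mono' ((meas z).inter (meas w)) fun ζ hζ ↦ ?_
          rcases one_div_rpow_mul_rpow_le (hr.trans_le hζ.1) (hr.trans_le hζ.2) hα hβ with h | h
          · exact (ENNReal.ofReal_le_ofReal h).trans le_self_add
          · exact (ENNReal.ofReal_le_ofReal h).trans le_add_self
      _ = _ := lintegral_add_left (by fun_prop) _
      _ ≤ _ := add_le_add ((lintegral_mono_set Set.inter_subset_left).trans (hB z))
          ((lintegral_mono_set Set.inter_subset_right).trans (hB w))
  have hcover : (Set.univ : Set X) ⊆
      (ball z r ∪ ball w r) ∪ ({ζ | r ≤ dist ζ z} ∩ {ζ | r ≤ dist ζ w}) := by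
    intro ζ _
    simp only [Set.mem_union, Set.mem_inter_iff, mem_ball, Set.mem_ofPred_eq]
    grind
  rw [← setLIntegral_univ]
  calc _ ≤ _ := lintegral_mono_set hcover
    _ ≤ _ := lintegral_union_le _ _ _
    _ ≤ _ := add_le_add ((lintegral_union_le _ _ _).trans
        (add_le_add (lintegral_two_pole_near_le hC hm h hα hα' hβ hr hzw) hnear)) hfar
    _ = _ := by
        rw [← ENNReal.ofReal_add (by positivity) (by positivity),
          ← ENNReal.ofReal_add (by positivity) (by positivity),
          ← ENNReal.ofReal_add (by positivity) (by positivity)]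
        ring_nf

end PowerIntegrals

/-- In a proper normed group, sets of bounded diameter are covered by a uniform number of balls, so an upper regularity bound at small scales holds at all scales on such sets. -/
theorem exists_restrict_ball_le {E : Type*} [NormedAddCommGroup E] [ProperSpace E]
    {C₀ R m : ℝ} (hC₀ : 0 < C₀) (hR : 0 < R) (hm : 0 ≤ m) (d₀ : ℝ) :
    ∃ C M : ℝ, 0 < C ∧ 0 < M ∧ ∀ [MeasurableSpace E] [OpensMeasurableSpace E] (μ : Measure E),
      (∀ w ρ, 0 < ρ → ρ ≤ R → μ (ball w ρ) ≤ ENNReal.ofReal (C₀ * ρ ^ m)) →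
      ∀ D : Set E, Bornology.IsBounded D → diam D ≤ d₀ →
        μ.restrict D Set.univ ≤ ENNReal.ofReal M ∧
        ∀ w ρ, 0 < ρ → μ.restrict D (ball w ρ) ≤ ENNReal.ofReal (C * ρ ^ m) := by
  obtain ⟨t, -, htf, ht⟩ := (isCompact_closedBall (0 : E) d₀).finite_cover_balls hR
  lift t to Finset E using htf
  refine ⟨(t.card + 1) * C₀, (t.card + 1) * C₀ * R ^ m, by positivity, by positivity, ?_⟩
  intro _ _ μ hμ D hD hd
  have hmass : μ D ≤ ENNReal.ofReal ((t.card + 1) * C₀ * R ^ m) := by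
    rcases D.eq_empty_or_nonempty with rfl | ⟨p, hp⟩
    · simp
    have hcover : D ⊆ ⋃ y ∈ t, ball (p + y) R := by
      intro ζ hζ
      have hmem : ζ - p ∈ closedBall (0 : E) d₀ := by
        rw [mem_closedBall_zero_iff, ← dist_eq_norm]
        exact (dist_le_diam_of_mem hD hζ hp).trans hd
      obtain ⟨y, hy, hζy⟩ := Set.mem_iUnion₂.1 (ht hmem)
      refine Set.mem_iUnion₂.2 ⟨y, hy, ?_⟩
      rw [mem_ball, dist_eq_norm] at hζy ⊢
      rwa [← sub_sub]
    calc μ D ≤ _ := measure_mono hcover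
      _ ≤ _ := measure_biUnion_finset_le _ _
      _ ≤ ∑ y ∈ t, ENNReal.ofReal (C₀ * R ^ m) := Finset.sum_le_sum fun y _ ↦ hμ _ R hR le_rfl
      _ = ENNReal.ofReal (t.card * (C₀ * R ^ m)) := by
          rw [← ENNReal.ofReal_sum_of_nonneg (fun _ _ ↦ by positivity)]
          simp
      _ ≤ _ := by
          refine ENNReal.ofReal_le_ofReal ?_
          rw [mul_assoc]
          gcongr
          linarith
  refine ⟨by simpa using hmass, fun w ρ hρ ↦ ?_⟩
  rcases le_total ρ R with hρR | hρR
  · refine (Measure.restrict_apply_le _ _).trans ((hμ w ρ hρ hρR).trans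
      (ENNReal.ofReal_le_ofReal ?_))
    gcongr
    exact le_mul_of_one_le_left hC₀.le (by linarith [Nat.cast_nonneg (α := ℝ) t.card])
  · calc μ.restrict D (ball w ρ) ≤ μ.restrict D Set.univ := measure_mono (Set.subset_univ _)
      _ ≤ ENNReal.ofReal ((t.card + 1) * C₀ * R ^ m) := by simpa using hmass
      _ ≤ _ := by gcongr

/-- The basic two-pole estimate: for a measure with an upper Ahlfors regularity bound of
exponent `2n` and a bounded Borel set `D` of diameter at most `d₀`, the integral of
`‖ζ-z‖^{-α} ‖ζ-w‖^{-β}` over `D` is bounded in terms of `‖z - w‖`. -/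
theorem two_pole_estimate
    (n N : ℕ) (hn : 1 ≤ n) (hN : 1 ≤ N) (C₀ R : ℝ) (hC₀ : 0 < C₀) (hR : 0 < R)
    (α β : ℝ) (hα : 0 ≤ α) (hα' : α < 2 * n) (hβ : 0 ≤ β) (hβ' : β < 2 * n)
    (d₀ : ℝ) (hd₀ : 0 < d₀) :
    ∃ C₂ : ℝ, 0 < C₂ ∧
      ∀ [MeasurableSpace (EuclideanSpace ℂ (Fin N))]
        [BorelSpace (EuclideanSpace ℂ (Fin N))]
        (μ : Measure (EuclideanSpace ℂ (Fin N))),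
        (∀ (w : EuclideanSpace ℂ (Fin N)) (ρ : ℝ), 0 < ρ → ρ ≤ R →
          μ (ball w ρ) ≤ ENNReal.ofReal (C₀ * ρ ^ (2 * n))) →
        ∀ D : Set (EuclideanSpace ℂ (Fin N)), MeasurableSet D → Bornology.IsBounded D →
          Metric.diam D ≤ d₀ →
          ∀ z w : EuclideanSpace ℂ (Fin N), z ≠ w →
            (α + β < 2 * n →
              (∫⁻ ζ in D, ENNReal.ofReal (1 / (‖ζ - z‖ ^ α * ‖ζ - w‖ ^ β)) ∂μ) ≤
                ENNReal.ofReal C₂) ∧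
            (α + β = 2 * n →
              (∫⁻ ζ in D, ENNReal.ofReal (1 / (‖ζ - z‖ ^ α * ‖ζ - w‖ ^ β)) ∂μ) ≤
                ENNReal.ofReal (C₂ * (1 + |Real.log ‖z - w‖|))) ∧
            (2 * n < α + β →
              (∫⁻ ζ in D, ENNReal.ofReal (1 / (‖ζ - z‖ ^ α * ‖ζ - w‖ ^ β)) ∂μ) ≤
                ENNReal.ofReal (C₂ * ‖z - w‖ ^ (2 * n - α - β))) := by
  have hm : (0 : ℝ) < 2 * n := by positivity
  obtain ⟨C, M, hC, hM, hreg⟩ :=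
    exists_restrict_ball_le (E := EuclideanSpace ℂ (Fin N)) hC₀ hR hm.le d₀
  have hpow (ρ : ℝ) : ρ ^ (2 * n) = ρ ^ (2 * n : ℝ) := by
    rw [← Real.rpow_natCast]
    norm_num
  simp only [hpow, ← dist_eq_norm]
  have hK {a : ℝ} (ha : a < 2 * n) : 0 < C * 4 ^ (2 * n : ℝ) / (1 - 2 ^ (a - 2 * n)) :=
    div_pos (by positivity) (sub_pos.2
      (Real.rpow_lt_one_of_one_lt_of_neg one_lt_two (by linarith)))
  have hKα := hK hα'
  have hKβ := hK hβ'
  rcases lt_trichotomy (α + β) (2 * n) with hlt | heq | hgt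
  · have hKs := hK hlt
    refine ⟨2 * (C * 4 ^ (2 * n : ℝ) / (1 - 2 ^ (α + β - 2 * n)) + M), by positivity, ?_⟩
    intro _ _ μ hμ D _ hD hd z w _
    obtain ⟨hmass, hball⟩ := hreg μ hμ D hD hd
    exact ⟨fun _ ↦ lintegral_two_pole_le_of_lt hC.le hm hball hM.le hmass hα hβ hlt z w,
      fun h ↦ absurd h hlt.ne, fun h ↦ absurd h hlt.not_gt⟩
  · have hlog : 0 < Real.log 2 := Real.log_pos one_lt_two
    refine ⟨C * 4 ^ (2 * n : ℝ) / (1 - 2 ^ (α - 2 * n)) +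
      C * 4 ^ (2 * n : ℝ) / (1 - 2 ^ (β - 2 * n)) +
      2 * (C * 4 ^ (2 * n : ℝ) * (2 + 1 / Real.log 2) + M), by positivity, ?_⟩
    intro _ _ μ hμ D _ hD hd z w hzw
    obtain ⟨hmass, hball⟩ := hreg μ hμ D hD hd
    refine ⟨fun h ↦ absurd h heq.not_lt, fun _ ↦ ?_, fun h ↦ absurd h heq.not_gt⟩
    have hδ : 0 < dist z w := dist_pos.2 hzw
    refine (lintegral_two_pole_le_add hC.le hm hball hα hα' hβ hβ' (half_pos hδ)
      (by linarith)
      (B := C * 4 ^ (2 * n : ℝ) * (|Real.log (dist z w / 2)| / Real.log 2 + 1) + M)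
      (by positivity) fun p ↦ ?_).trans (ENNReal.ofReal_le_ofReal ?_)
    · rw [heq]
      exact lintegral_compl_ball_le_log hC.le hm hball hM.le hmass (half_pos hδ) p
    · have hle : |Real.log (dist z w / 2)| / Real.log 2 + 1 ≤
          (2 + 1 / Real.log 2) * (1 + |Real.log (dist z w)|) := by
        have hsub : |Real.log (dist z w / 2)| ≤ |Real.log (dist z w)| + Real.log 2 := by
          rw [Real.log_div hδ.ne' (by norm_num)]
          exact (abs_sub _ _).trans_eq (by rw [abs_of_pos hlog])
        calc _ ≤ (|Real.log (dist z w)| + Real.log 2) / Real.log 2 + 1 := by gcongr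
          _ = 2 + 1 / Real.log 2 * |Real.log (dist z w)| := by
              field_simp
              ring
          _ ≤ _ := by
              have : 0 < 1 / Real.log 2 := by positivity
              nlinarith [abs_nonneg (Real.log (dist z w))]
      have hL := abs_nonneg (Real.log (dist z w))
      rw [heq, sub_self, Real.rpow_zero, mul_one, add_mul, mul_assoc 2, add_mul _ M]
      gcongr ?_ + 2 * (?_ + ?_)
      · exact le_mul_of_one_le_right (by positivity) (by linarith)
      · rw [mul_assoc (C * 4 ^ (2 * n : ℝ))]
        gcongr
      · exact le_mul_of_one_le_right hM.le (by linarith)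
  · have hKs : 0 < C * 4 ^ (2 * n : ℝ) / (1 - 2 ^ (2 * n - (α + β))) :=
      div_pos (by positivity) (sub_pos.2
        (Real.rpow_lt_one_of_one_lt_of_neg one_lt_two (by linarith)))
    refine ⟨(C * 4 ^ (2 * n : ℝ) / (1 - 2 ^ (α - 2 * n)) +
      C * 4 ^ (2 * n : ℝ) / (1 - 2 ^ (β - 2 * n)) +
      2 * (C * 4 ^ (2 * n : ℝ) / (1 - 2 ^ (2 * n - (α + β))))) /
        2 ^ (2 * n - (α + β)), by positivity, ?_⟩
    intro _ _ μ hμ D _ hD hd z w hzw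
    obtain ⟨hmass, hball⟩ := hreg μ hμ D hD hd
    refine ⟨fun h ↦ absurd h hgt.not_gt, fun h ↦ absurd h hgt.ne', fun _ ↦ ?_⟩
    have hδ : 0 < dist z w := dist_pos.2 hzw
    refine (lintegral_two_pole_le_add hC.le hm hball hα hα' hβ hβ' (half_pos hδ)
      (by linarith) (by positivity) fun p ↦ lintegral_compl_ball_le hC.le hball (by positivity) hgt
        (half_pos hδ) p).trans_eq ?_
    rw [Real.div_rpow hδ.le (by norm_num), ← sub_sub]
    ring_nf
end

section
/- Let n ≥ 1 and N ≥ 1 be integers, and let μ be a finite Borel measure on ℂ^N with bounded support for which there are constants C₀ > 0 and R > 0 with μ(B_ρ(w)) ≤ C₀ ρ^{2n} for every w ∈ ℂ^N and every 0 < ρ ≤ R. Fix 0 ≤ γ < 2n, define k_γ(ζ, z) := ‖z‖^γ / ( ‖ζ‖^γ · ‖ζ − z‖^{2n−1} ), and let 2n/(2n − γ) < p < ∞. Then the map T, defined by T f(z) := ∫ f(ζ) k_γ(ζ, z) dμ(ζ), is a compact operator from L^p(μ) to L^p(μ): T is a bounded linear operator and the image under T of the unit ball of L^p(μ) is relatively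 compact in L^p(μ). -/
open MeasureTheory Metric
open scoped NNReal ENNReal

/-- Uniform bound for the Riesz potential of exponent `t < d` of a finite measure that is upper
Ahlfors regular of exponent `d`. -/
theorem exists_lintegral_norm_sub_rpow_neg_le {E : Type*} [NormedAddCommGroup E]
    [MeasurableSpace E] [BorelSpace E] (μ : Measure E) [IsFiniteMeasure μ] {C₀ R d t : ℝ}
    (hC₀ : 0 ≤ C₀) (hR : 0 < R)
    (hμ : ∀ (w : E) (ρ : ℝ), 0 < ρ → ρ ≤ R → μ (ball w ρ) ≤ ENNReal.ofReal (C₀ * ρ ^ d))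
    (ht : 0 ≤ t) (htd : t < d) :
    ∃ M : ℝ≥0∞, M ≠ ⊤ ∧ ∀ w : E, ∫⁻ ζ, ENNReal.ofReal (‖ζ - w‖ ^ (-t)) ∂μ ≤ M := by
  set y : ℝ := 1 / 2 with hy
  have hy0 : 0 < y := by norm_num [hy]
  have hy1 : y < 1 := by norm_num [hy]
  set c : ℕ → ℝ := fun j => ((R / 2) * y ^ (j + 1)) ^ (-t) with hc
  have hc0 : ∀ j, 0 ≤ c j := fun j => by positivity
  have hpt : ∀ w ζ : E, ENNReal.ofReal (‖ζ - w‖ ^ (-t)) ≤ ENNReal.ofReal ((R / 2) ^ (-t)) +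
      ∑' j, (ball w (R * y ^ j)).indicator (fun _ => ENNReal.ofReal (c j)) ζ := by
    intro w ζ
    rcases eq_or_lt_of_le (norm_nonneg (ζ - w)) with h0 | h0
    · refine le_trans (ENNReal.ofReal_le_ofReal ?_) le_self_add
      rw [← h0]
      rcases eq_or_lt_of_le ht with h | h
      · simp [← h]
      · rw [Real.zero_rpow (by linarith)]; positivity
    rcases le_or_gt (R / 2) ‖ζ - w‖ with h1 | h1
    · refine le_trans (ENNReal.ofReal_le_ofReal ?_) le_self_add
      exact Real.rpow_le_rpow_of_nonpos (by positivity) h1 (by linarith)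
    · obtain ⟨j, hj1, hj2⟩ := exists_nat_pow_near_of_lt_one (x := ‖ζ - w‖ / (R / 2)) (y := y)
        (by positivity) ((div_le_one (by positivity)).2 h1.le) hy0 hy1
      rw [lt_div_iff₀ (by positivity)] at hj1
      rw [div_le_iff₀ (by positivity)] at hj2
      have hyj : 0 < y ^ j := by positivity
      refine le_trans ?_ (le_trans (ENNReal.le_tsum j) le_add_self)
      rw [Set.indicator_of_mem]
      · refine ENNReal.ofReal_le_ofReal ?_
        exact Real.rpow_le_rpow_of_nonpos (by positivity) (by linarith) (by linarith)
      · rw [mem_ball, dist_eq_norm]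
        nlinarith
  refine ⟨ENNReal.ofReal ((R / 2) ^ (-t)) * μ Set.univ +
      ∑' j, ENNReal.ofReal (c j) * ENNReal.ofReal (C₀ * (R * y ^ j) ^ d), ?_, fun w => ?_⟩
  · refine ENNReal.add_ne_top.2 ⟨ENNReal.mul_ne_top ENNReal.ofReal_ne_top (measure_ne_top _ _), ?_⟩
    have : ∀ j : ℕ, ENNReal.ofReal (c j) * ENNReal.ofReal (C₀ * (R * y ^ j) ^ d) =
        ENNReal.ofReal (((R / 2 * y) ^ (-t) * (C₀ * R ^ d)) * (y ^ (d - t)) ^ j) := by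
      intro j
      rw [← ENNReal.ofReal_mul (hc0 j)]
      congr 1
      simp only [hc]
      rw [pow_succ', ← mul_assoc (R / 2), Real.mul_rpow (by positivity) (by positivity),
        Real.mul_rpow hR.le (by positivity), ← Real.rpow_natCast, ← Real.rpow_natCast,
        ← Real.rpow_mul hy0.le, ← Real.rpow_mul hy0.le, ← Real.rpow_mul hy0.le]
      have : y ^ ((d - t) * (j : ℝ)) = y ^ ((j : ℝ) * -t) * y ^ ((j : ℝ) * d) := by
        rw [← Real.rpow_add hy0]; congr 1; ring
      rw [this]; ring
    simp_rw [this]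
    rw [← ENNReal.ofReal_tsum_of_nonneg (fun j => by positivity)]
    · exact ENNReal.ofReal_ne_top
    · exact (summable_geometric_of_lt_one (by positivity)
        (Real.rpow_lt_one hy0.le hy1 (by linarith))).mul_left _
  · refine (lintegral_mono (hpt w)).trans ?_
    rw [lintegral_add_left measurable_const, lintegral_const, lintegral_tsum]
    · gcongr with j
      rw [lintegral_indicator measurableSet_ball, setLIntegral_const]
      gcongr
      refine hμ w _ (by positivity) ?_
      have : y ^ j ≤ 1 := pow_le_one₀ hy0.le hy1.le
      nlinarith
    · exact fun j => (measurable_const.indicator measurableSet_ball).aemeasurable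

theorem rpow_mul_rpow_neg_le_one {x : ℝ} (hx : 0 ≤ x) (s : ℝ) : x ^ s * x ^ (-s) ≤ 1 := by
  rw [Real.rpow_neg hx]
  exact mul_inv_le_one

theorem norm_rpow_mul_norm_sub_rpow_le {E : Type*} [NormedAddCommGroup E] {R s t : ℝ}
    (hs : 0 ≤ s) {z ζ : E} (hz : ‖z‖ ≤ R) (hζ : ‖ζ‖ ≤ R) :
    ‖z‖ ^ s * ‖ζ‖ ^ (-s) * ‖ζ - z‖ ^ (-t) ≤
      2 ^ s * (‖ζ - z‖ ^ (-t) + (2 * R) ^ (s - t) * ‖ζ‖ ^ (-s) + ‖ζ‖ ^ (-t)) := by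
  have hR : 0 ≤ R := (norm_nonneg z).trans hz
  have htri : ‖z‖ ≤ ‖ζ‖ + ‖ζ - z‖ := by
    have := norm_sub_le ζ (ζ - z); simpa using this
  have htri' : ‖ζ - z‖ ≤ ‖ζ‖ + ‖z‖ := norm_sub_le ζ z
  set a := ‖ζ - z‖ with ha
  set b := ‖ζ‖ with hb
  have ha0 : 0 ≤ a := norm_nonneg _
  have hb0 : 0 ≤ b := norm_nonneg _
  have h2 : (0 : ℝ) < 2 ^ s := by positivity
  have e1 : 0 ≤ a ^ (-t) := by positivity
  have e2 : 0 ≤ (2 * R) ^ (s - t) * b ^ (-s) := by positivity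
  have e3 : 0 ≤ b ^ (-t) := by positivity
  rcases le_or_gt a b with h | h
  · have h1 : ‖z‖ ^ s ≤ 2 ^ s * b ^ s := by
      rw [← Real.mul_rpow (by norm_num) hb0]
      exact Real.rpow_le_rpow (norm_nonneg _) (by linarith) hs
    calc ‖z‖ ^ s * b ^ (-s) * a ^ (-t) ≤ 2 ^ s * b ^ s * b ^ (-s) * a ^ (-t) := by gcongr
      _ = 2 ^ s * ((b ^ s * b ^ (-s)) * a ^ (-t)) := by ring
      _ ≤ 2 ^ s * (1 * a ^ (-t)) := by gcongr; exact rpow_mul_rpow_neg_le_one hb0 s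
      _ ≤ _ := by gcongr; linarith
  · have ha' : 0 < a := hb0.trans_lt h
    have h1 : ‖z‖ ^ s ≤ 2 ^ s * a ^ s := by
      rw [← Real.mul_rpow (by norm_num) ha0]
      exact Real.rpow_le_rpow (norm_nonneg _) (by linarith) hs
    have h3 : a ^ (s - t) * b ^ (-s) ≤ a ^ (-t) + (2 * R) ^ (s - t) * b ^ (-s) + b ^ (-t) := by
      rcases le_or_gt t s with hts | hts
      · have : a ^ (s - t) ≤ (2 * R) ^ (s - t) :=
          Real.rpow_le_rpow ha0 (by linarith) (by linarith)
        have : a ^ (s - t) * b ^ (-s) ≤ (2 * R) ^ (s - t) * b ^ (-s) := by gcongr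
        linarith
      · rcases eq_or_lt_of_le hb0 with hb' | hb'
        · rcases eq_or_lt_of_le hs with hs' | hs'
          · rw [← hs'] at e2 ⊢
            simp only [zero_sub, neg_zero, Real.rpow_zero, mul_one] at e2 ⊢
            linarith
          · have hbs : b ^ (-s) = 0 := by rw [← hb', Real.zero_rpow (by linarith)]
            rw [hbs, mul_zero, mul_zero, add_zero]
            exact add_nonneg e1 e3
        · have : a ^ (s - t) ≤ b ^ (s - t) :=
            Real.rpow_le_rpow_of_nonpos hb' h.le (by linarith)
          have h5 : a ^ (s - t) * b ^ (-s) ≤ b ^ (s - t) * b ^ (-s) := by gcongr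
          rw [← Real.rpow_add hb', show s - t + -s = -t by ring] at h5
          linarith
    calc ‖z‖ ^ s * b ^ (-s) * a ^ (-t) ≤ 2 ^ s * a ^ s * b ^ (-s) * a ^ (-t) := by gcongr
      _ = 2 ^ s * (a ^ (s - t) * b ^ (-s)) := by
        rw [show s - t = s + -t by ring, Real.rpow_add ha']; ring
      _ ≤ _ := by gcongr

theorem exists_lintegral_weighted_norm_sub_rpow_neg_le {E : Type*} [NormedAddCommGroup E]
    [MeasurableSpace E] [BorelSpace E] (μ : Measure E) {R₁ s t : ℝ}
    (hsupp : ∀ᵐ ζ ∂μ, ‖ζ‖ ≤ R₁)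
    (hpot : ∀ r : ℝ, r = s ∨ r = t → ∃ M : ℝ≥0∞, M ≠ ⊤ ∧
      ∀ w : E, ∫⁻ ζ, ENNReal.ofReal (‖ζ - w‖ ^ (-r)) ∂μ ≤ M) (hs : 0 ≤ s) :
    ∃ M : ℝ≥0∞, M ≠ ⊤ ∧ ∀ z : E, ‖z‖ ≤ R₁ →
      ∫⁻ ζ, ENNReal.ofReal (‖z‖ ^ s * ‖ζ‖ ^ (-s) * ‖ζ - z‖ ^ (-t)) ∂μ ≤ M := by
  obtain ⟨Ms, hMs, hs'⟩ := hpot s (Or.inl rfl)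
  obtain ⟨Mt, hMt, ht'⟩ := hpot t (Or.inr rfl)
  have hs0 := hs' 0
  have ht0 := ht' 0
  simp only [sub_zero] at hs0 ht0
  refine ⟨ENNReal.ofReal (2 ^ s) * (Mt + ENNReal.ofReal ((2 * R₁) ^ (s - t)) * Ms + Mt), ?_,
    fun z hz => ?_⟩
  · finiteness
  have hR : 0 ≤ R₁ := (norm_nonneg z).trans hz
  have hmeas : ∀ r : ℝ, ∀ w : E, Measurable fun ζ : E => ENNReal.ofReal (‖ζ - w‖ ^ (-r)) := by
    intro r w
    have : Measurable fun ζ : E => ‖ζ - w‖ := (continuous_id.sub continuous_const).norm.measurable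
    exact (this.pow_const _).ennreal_ofReal
  have hm0 : ∀ r : ℝ, Measurable fun ζ : E => ENNReal.ofReal (‖ζ‖ ^ (-r)) := by
    intro r; simpa using hmeas r 0
  calc ∫⁻ ζ, ENNReal.ofReal (‖z‖ ^ s * ‖ζ‖ ^ (-s) * ‖ζ - z‖ ^ (-t)) ∂μ
      ≤ ∫⁻ ζ, ENNReal.ofReal (2 ^ s) * (ENNReal.ofReal (‖ζ - z‖ ^ (-t)) +
          ENNReal.ofReal ((2 * R₁) ^ (s - t)) * ENNReal.ofReal (‖ζ‖ ^ (-s)) +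
          ENNReal.ofReal (‖ζ‖ ^ (-t))) ∂μ := by
        refine lintegral_mono_ae (hsupp.mono fun ζ hζ => ?_)
        rw [← ENNReal.ofReal_mul (by positivity), ← ENNReal.ofReal_add (by positivity)
          (by positivity), ← ENNReal.ofReal_add (by positivity) (by positivity),
          ← ENNReal.ofReal_mul (by positivity)]
        exact ENNReal.ofReal_le_ofReal (norm_rpow_mul_norm_sub_rpow_le hs hz hζ)
    _ ≤ _ := by
        have h1 := hmeas t z
        have h2 := hm0 s
        have h3 := hm0 t
        rw [lintegral_const_mul _ (by fun_prop), lintegral_add_left (by fun_prop),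
          lintegral_add_left (by fun_prop), lintegral_const_mul _ (by fun_prop)]
        gcongr
        exact ht' z

/-- Weighted Schur test for the kernel `‖z‖^γ ‖ζ‖^{-γ} ‖ζ-z‖^{-t}`. -/
theorem exists_lintegral_rpow_lintegral_kernel_le {E : Type*} [NormedAddCommGroup E]
    [MeasurableSpace E] [BorelSpace E] [SecondCountableTopology E] (μ : Measure E)
    [IsFiniteMeasure μ] {R₁ γ t P Q : ℝ} (hPQ : P.HolderConjugate Q) (hγ : 0 ≤ γ)
    (hsupp : ∀ᵐ ζ ∂μ, ‖ζ‖ ≤ R₁)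
    (hpot : ∀ r : ℝ, r = γ * Q ∨ r = t → ∃ M : ℝ≥0∞, M ≠ ⊤ ∧
      ∀ w : E, ∫⁻ ζ, ENNReal.ofReal (‖ζ - w‖ ^ (-r)) ∂μ ≤ M) :
    ∃ C : ℝ≥0∞, C ≠ ⊤ ∧ ∀ F : E → ℝ≥0∞, Measurable F →
      ∫⁻ z, (∫⁻ ζ, F ζ * ENNReal.ofReal (‖z‖ ^ γ * ‖ζ‖ ^ (-γ) * ‖ζ - z‖ ^ (-t)) ∂μ) ^ P ∂μ ≤
        C * ∫⁻ ζ, F ζ ^ P ∂μ := by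
  have hP := hPQ.pos
  have hQ := hPQ.symm.pos
  obtain ⟨A, hA, hA'⟩ := exists_lintegral_weighted_norm_sub_rpow_neg_le μ hsupp hpot
    (mul_nonneg hγ hQ.le)
  obtain ⟨B, hB, hB'⟩ := hpot t (Or.inr rfl)
  refine ⟨(A ^ (1 / Q)) ^ P * B, by finiteness, fun F hF => ?_⟩
  set D : E → E → ℝ≥0∞ := fun ζ z => ENNReal.ofReal (‖ζ - z‖ ^ (-t)) with hD
  have hDm : Measurable (Function.uncurry D) := by
    have : Measurable fun x : E × E => ‖x.1 - x.2‖ :=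
      (continuous_fst.sub continuous_snd).norm.measurable
    exact (this.pow_const _).ennreal_ofReal
  have hDz : ∀ z, Measurable fun ζ => D ζ z := fun z => hDm.of_uncurry_right
  have hz : ∀ z : E, ‖z‖ ≤ R₁ →
      (∫⁻ ζ, F ζ * ENNReal.ofReal (‖z‖ ^ γ * ‖ζ‖ ^ (-γ) * ‖ζ - z‖ ^ (-t)) ∂μ) ^ P ≤
        (A ^ (1 / Q)) ^ P * ∫⁻ ζ, F ζ ^ P * D ζ z ∂μ := by
    intro z hz
    set a : E → ℝ≥0∞ := fun ζ => ENNReal.ofReal (‖z‖ ^ γ * ‖ζ‖ ^ (-γ)) with ha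
    have ham : Measurable a := by
      have : Measurable fun ζ : E => ‖ζ‖ := continuous_norm.measurable
      exact ((this.pow_const _).const_mul _).ennreal_ofReal
    have hsplit : ∀ ζ, F ζ * ENNReal.ofReal (‖z‖ ^ γ * ‖ζ‖ ^ (-γ) * ‖ζ - z‖ ^ (-t)) =
        ((fun ζ => F ζ * D ζ z ^ (1 / P)) * (fun ζ => a ζ * D ζ z ^ (1 / Q))) ζ := by
      intro ζ
      rw [ENNReal.ofReal_mul (by positivity)]
      have : D ζ z = D ζ z ^ (1 / P) * D ζ z ^ (1 / Q) := by
        rw [← ENNReal.rpow_add_of_nonneg _ _ (by positivity) (by positivity), one_div, one_div,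
          hPQ.inv_add_inv_eq_one, ENNReal.rpow_one]
      calc F ζ * (a ζ * D ζ z) = F ζ * (a ζ * (D ζ z ^ (1 / P) * D ζ z ^ (1 / Q))) := by
            rw [← this]
        _ = F ζ * D ζ z ^ (1 / P) * (a ζ * D ζ z ^ (1 / Q)) := by ring
    have h1 : ∀ ζ, (F ζ * D ζ z ^ (1 / P)) ^ P = F ζ ^ P * D ζ z := by
      intro ζ
      rw [ENNReal.mul_rpow_of_nonneg _ _ hP.le, ← ENNReal.rpow_mul, one_div_mul_cancel hP.ne',
        ENNReal.rpow_one]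
    have h2 : ∀ ζ, (a ζ * D ζ z ^ (1 / Q)) ^ Q =
        ENNReal.ofReal (‖z‖ ^ (γ * Q) * ‖ζ‖ ^ (-(γ * Q)) * ‖ζ - z‖ ^ (-t)) := by
      intro ζ
      rw [ENNReal.mul_rpow_of_nonneg _ _ hQ.le, ← ENNReal.rpow_mul, one_div_mul_cancel hQ.ne',
        ENNReal.rpow_one, ENNReal.ofReal_mul (by positivity),
        ENNReal.ofReal_rpow_of_nonneg (by positivity) hQ.le,
        Real.mul_rpow (by positivity) (by positivity), ← Real.rpow_mul (norm_nonneg _),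
        ← Real.rpow_mul (norm_nonneg _), neg_mul]
    have hH := ENNReal.lintegral_mul_le_Lp_mul_Lq μ hPQ
      (f := fun ζ => F ζ * D ζ z ^ (1 / P)) (g := fun ζ => a ζ * D ζ z ^ (1 / Q))
      (hF.mul ((hDz z).pow_const _)).aemeasurable (ham.mul ((hDz z).pow_const _)).aemeasurable
    simp only [h1, h2] at hH
    simp only [hsplit]
    calc _ ≤ ((∫⁻ ζ, F ζ ^ P * D ζ z ∂μ) ^ (1 / P) * A ^ (1 / Q)) ^ P := by
          refine ENNReal.rpow_le_rpow (hH.trans ?_) hP.le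
          gcongr
          exact hA' z hz
      _ = _ := by
          rw [ENNReal.mul_rpow_of_nonneg _ _ hP.le, ← ENNReal.rpow_mul, one_div_mul_cancel hP.ne',
            ENNReal.rpow_one, mul_comm]
  calc _ ≤ ∫⁻ z, (A ^ (1 / Q)) ^ P * ∫⁻ ζ, F ζ ^ P * D ζ z ∂μ ∂μ :=
        lintegral_mono_ae (hsupp.mono hz)
    _ = (A ^ (1 / Q)) ^ P * ∫⁻ z, ∫⁻ ζ, F ζ ^ P * D ζ z ∂μ ∂μ := by
        rw [lintegral_const_mul' _ _ (by finiteness)]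
    _ = (A ^ (1 / Q)) ^ P * ∫⁻ ζ, ∫⁻ z, F ζ ^ P * D ζ z ∂μ ∂μ := by
        rw [lintegral_lintegral_swap]
        have : Measurable (fun x : E × E => D x.2 x.1) := hDm.comp measurable_swap
        exact (((hF.comp measurable_snd).pow_const _).mul this).aemeasurable
    _ ≤ (A ^ (1 / Q)) ^ P * ∫⁻ ζ, F ζ ^ P * B ∂μ := by
        gcongr with ζ
        rw [lintegral_const_mul _ (hDm.of_uncurry_left)]
        gcongr
        simpa only [hD, norm_sub_rev] using hB' ζ
    _ = _ := by
        rw [lintegral_mul_const _ (hF.pow_const _)]; ring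

/-- An operator bounded, up to a small multiple of the norm, by finitely many functionals maps the
unit ball to a relatively compact set. -/
theorem isCompact_closure_image_ball_of_norm_le {F G ι : Type*}
    [SeminormedAddCommGroup F] [NormedSpace ℂ F] [NormedAddCommGroup G] [NormedSpace ℂ G]
    [CompleteSpace G] (T : F →L[ℂ] G)
    (h : ∀ ε > 0, ∃ (s : Finset ι) (ψ : ι → F →L[ℂ] ℂ) (C : ℝ), 0 ≤ C ∧
      ∀ f, ‖T f‖ ≤ ε * ‖f‖ + C * ∑ i ∈ s, ‖ψ i f‖) :
    IsCompact (closure (T '' ball 0 1)) := by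
  refine TotallyBounded.isCompact_of_isClosed (TotallyBounded.closure ?_) isClosed_closure
  refine totallyBounded_of_finite_discretization fun ε hε => ?_
  obtain ⟨s, ψ, C, hC, hT⟩ := h (ε / 4) (by positivity)
  set φ : F →L[ℂ] (s → ℂ) := ContinuousLinearMap.pi fun i => ψ i with hφ
  set η : ℝ := ε / (4 * (C * s.card + 1)) with hη
  have hη0 : 0 < η := by positivity
  have htb : TotallyBounded (φ '' ball 0 1) :=
    ((φ.lipschitz.isBounded_image isBounded_ball).isCompact_closure.totallyBounded).subset
      subset_closure
  obtain ⟨t, ht, hcov⟩ := totallyBounded_iff.1 htb η hη0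
  have hex : ∀ x : ↥(T '' ball 0 1), ∃ f : F, f ∈ ball (0 : F) 1 ∧ T f = x := fun x => x.2
  choose f hf hfx using hex
  have hcen : ∀ x, ∃ y, y ∈ t ∧ φ (f x) ∈ ball y η := by
    intro x
    simpa using hcov ⟨f x, hf x, rfl⟩
  choose y hyt hy using hcen
  have := ht.fintype
  refine ⟨ULift (Fin (Fintype.card t)), inferInstance,
    fun x => ⟨Fintype.equivFin t ⟨y x, hyt x⟩⟩, fun a b hab => ?_⟩
  have hab' : y a = y b := by simpa using hab
  have hd : ‖φ (f a - f b)‖ ≤ 2 * η := by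
    rw [map_sub, ← dist_eq_norm]
    have h1 := hy a
    have h2 := hy b
    rw [mem_ball] at h1 h2
    rw [← hab'] at h2
    linarith [dist_triangle_right (φ (f a)) (φ (f b)) (y a)]
  have hfab : ‖f a - f b‖ < 2 := by
    have h1 := hf a
    have h2 := hf b
    rw [mem_ball_zero_iff] at h1 h2
    linarith [norm_sub_le (f a) (f b)]
  have hsum : ∑ i ∈ s, ‖ψ i (f a - f b)‖ ≤ s.card * (2 * η) := by
    rw [← nsmul_eq_mul]
    refine Finset.sum_le_card_nsmul _ _ _ fun i hi => ?_
    exact (norm_le_pi_norm (φ (f a - f b)) ⟨i, hi⟩).trans hd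
  have hηeq : η * (4 * (C * s.card + 1)) = ε := div_mul_cancel₀ _ (by positivity)
  rw [← hfx a, ← hfx b, dist_eq_norm, ← map_sub]
  have h3 := hT (f a - f b)
  have h4 : C * ∑ i ∈ s, ‖ψ i (f a - f b)‖ ≤ C * (s.card * (2 * η)) := by gcongr
  nlinarith

/-- The real kernel `‖z‖^γ ‖ζ‖^{-γ} ‖ζ-z‖^{-t}`. -/
noncomputable def weightedKernel {E : Type*} [NormedAddCommGroup E] (γ t : ℝ) (ζ z : E) : ℝ :=
  ‖z‖ ^ γ * ‖ζ‖ ^ (-γ) * ‖ζ - z‖ ^ (-t)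

theorem weightedKernel_nonneg {E : Type*} [NormedAddCommGroup E] (γ t : ℝ) (ζ z : E) :
    0 ≤ weightedKernel γ t ζ z := by
  unfold weightedKernel; positivity

theorem measurable_weightedKernel {E : Type*} [NormedAddCommGroup E] [MeasurableSpace E]
    [BorelSpace E] [SecondCountableTopology E] (γ t : ℝ) :
    Measurable (Function.uncurry (weightedKernel (E := E) γ t)) := by
  have h1 : Measurable fun x : E × E => ‖x.1 - x.2‖ :=
    (continuous_fst.sub continuous_snd).norm.measurable
  have h2 : Measurable fun x : E × E => ‖x.1‖ := continuous_fst.norm.measurable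
  have h3 : Measurable fun x : E × E => ‖x.2‖ := continuous_snd.norm.measurable
  exact ((h3.pow_const _).mul (h2.pow_const _)).mul (h1.pow_const _)

theorem exists_eLpNorm_lintegral_weightedKernel_le {E : Type*} [NormedAddCommGroup E]
    [MeasurableSpace E] [BorelSpace E] [SecondCountableTopology E] (μ : Measure E)
    [IsFiniteMeasure μ] {R₁ γ t : ℝ} {p q : ℝ≥0∞} (hpq : p.toReal.HolderConjugate q.toReal)
    (hγ : 0 ≤ γ) (hsupp : ∀ᵐ ζ ∂μ, ‖ζ‖ ≤ R₁)
    (hpot : ∀ r : ℝ, r = γ * q.toReal ∨ r = t → ∃ M : ℝ≥0∞, M ≠ ⊤ ∧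
      ∀ w : E, ∫⁻ ζ, ENNReal.ofReal (‖ζ - w‖ ^ (-r)) ∂μ ≤ M) :
    ∃ C : ℝ≥0∞, C ≠ ⊤ ∧ ∀ f : Lp ℂ p μ,
      eLpNorm (fun z => ∫⁻ ζ, ‖f ζ‖ₑ * ENNReal.ofReal (weightedKernel γ t ζ z) ∂μ) p μ ≤
        C * ‖f‖ₑ := by
  have hP := hpq.pos
  obtain ⟨hp0, hpt⟩ := ENNReal.toReal_pos_iff.1 hP
  obtain ⟨C, hC, h⟩ := exists_lintegral_rpow_lintegral_kernel_le μ hpq hγ hsupp hpot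
  refine ⟨C ^ (1 / p.toReal), by finiteness, fun f => ?_⟩
  have hf := h (fun ζ => ‖f ζ‖ₑ) (Lp.stronglyMeasurable f).enorm
  rw [Lp.enorm_def, eLpNorm_eq_lintegral_rpow_enorm_toReal hp0.ne' hpt.ne,
    eLpNorm_eq_lintegral_rpow_enorm_toReal hp0.ne' hpt.ne,
    ← ENNReal.mul_rpow_of_nonneg _ _ (by positivity)]
  refine ENNReal.rpow_le_rpow ?_ (by positivity)
  simpa only [enorm_eq_self, weightedKernel] using hf

/-- A kernel satisfying an absolute `L^p` bound defines a bounded operator on `L^p`. -/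
theorem exists_continuousLinearMap_integral_kernel {E : Type*} [MeasurableSpace E]
    (μ : Measure E) [SFinite μ] {p : ℝ≥0∞} [Fact (1 ≤ p)] (hp : p ≠ ⊤) (K : E → E → ℂ)
    (hK : Measurable (Function.uncurry K)) {C : ℝ≥0∞} (hC : C ≠ ⊤)
    (h : ∀ f : Lp ℂ p μ, eLpNorm (fun z => ∫⁻ ζ, ‖f ζ‖ₑ * ‖K ζ z‖ₑ ∂μ) p μ ≤ C * ‖f‖ₑ) :
    ∃ T : Lp ℂ p μ →L[ℂ] Lp ℂ p μ, ∀ f : Lp ℂ p μ, ∀ᵐ z ∂μ, T f z = ∫ ζ, f ζ * K ζ z ∂μ := by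
  have hp0 : p ≠ 0 := (one_pos.trans_le (Fact.out : 1 ≤ p)).ne'
  have hsm : ∀ f : Lp ℂ p μ, StronglyMeasurable (fun x : E × E => f x.2 * K x.2 x.1) := by
    intro f
    exact (((Lp.stronglyMeasurable f).measurable.comp measurable_snd).mul
      (hK.comp measurable_swap)).stronglyMeasurable
  have hle : ∀ f : Lp ℂ p μ, eLpNorm (fun z => ∫ ζ, f ζ * K ζ z ∂μ) p μ ≤ C * ‖f‖ₑ := by
    intro f
    refine (eLpNorm_mono_enorm fun z => ?_).trans (h f)
    refine (enorm_integral_le_lintegral_enorm _).trans (le_of_eq ?_)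
    simp [enorm_mul]
  have hmem : ∀ f : Lp ℂ p μ, MemLp (fun z => ∫ ζ, f ζ * K ζ z ∂μ) p μ := fun f =>
    ⟨(hsm f).integral_prod_right'.aestronglyMeasurable,
      (hle f).trans_lt (ENNReal.mul_lt_top hC.lt_top enorm_lt_top)⟩
  have hint : ∀ f : Lp ℂ p μ, ∀ᵐ z ∂μ, Integrable (fun ζ => f ζ * K ζ z) μ := by
    intro f
    have hfin : ∫⁻ z, (∫⁻ ζ, ‖f ζ‖ₑ * ‖K ζ z‖ₑ ∂μ) ^ p.toReal ∂μ < ⊤ := by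
      have := (h f).trans_lt (ENNReal.mul_lt_top hC.lt_top enorm_lt_top)
      simpa using (eLpNorm_lt_top_iff_lintegral_rpow_enorm_lt_top hp0 hp).1 this
    have hme : Measurable fun z => ∫⁻ ζ, ‖f ζ‖ₑ * ‖K ζ z‖ₑ ∂μ := by
      have := (hsm f).enorm.lintegral_prod_right' (ν := μ)
      simpa [enorm_mul] using this
    filter_upwards [ae_lt_top (hme.pow_const _) hfin.ne] with z hz
    refine ⟨((hsm f).comp_measurable measurable_prodMk_left).aestronglyMeasurable, ?_⟩
    rw [HasFiniteIntegral]
    simp only [enorm_mul]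
    exact (ENNReal.rpow_lt_top_iff_of_pos (ENNReal.toReal_pos hp0 hp)).1 hz
  let L : Lp ℂ p μ →ₗ[ℂ] Lp ℂ p μ :=
    { toFun := fun f => (hmem f).toLp
      map_add' := fun f g => by
        rw [← MemLp.toLp_add]
        refine MemLp.toLp_congr _ _ ?_
        filter_upwards [hint f, hint g] with z hf hg
        rw [Pi.add_apply, ← integral_add hf hg]
        refine integral_congr_ae ?_
        filter_upwards [Lp.coeFn_add f g] with ζ hζ
        rw [hζ, Pi.add_apply, add_mul]
      map_smul' := fun c f => by
        rw [RingHom.id_apply, ← MemLp.toLp_const_smul]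
        refine MemLp.toLp_congr _ _ (Filter.Eventually.of_forall fun z => ?_)
        rw [Pi.smul_apply, ← integral_smul]
        refine integral_congr_ae ?_
        filter_upwards [Lp.coeFn_smul c f] with ζ hζ
        rw [hζ, Pi.smul_apply, smul_eq_mul, smul_eq_mul, mul_assoc] }
  refine ⟨L.mkContinuous C.toReal fun f => ?_, fun f => (hmem f).coeFn_toLp⟩
  change ‖(hmem f).toLp‖ ≤ _
  rw [Lp.norm_toLp, ← toReal_enorm f, ← ENNReal.toReal_mul]
  exact ENNReal.toReal_mono (ENNReal.mul_ne_top hC enorm_ne_top) (hle f)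

/-- Integration against the truncated kernel defines functionals on `L^p` that form a totally
bounded family as `z` ranges over a ball. -/
theorem exists_finset_dual_truncatedKernel {E : Type*} [NormedAddCommGroup E] [ProperSpace E]
    [MeasurableSpace E] [BorelSpace E] (μ : Measure E) {R₁ γ t δ : ℝ} {p q : ℝ≥0∞}
    [Fact (1 ≤ p)] (hpq : p.toReal.HolderConjugate q.toReal) (hγ : 0 ≤ γ) (ht : 0 ≤ t)
    (hδ : 0 < δ) (hsupp : ∀ᵐ ζ ∂μ, ‖ζ‖ ≤ R₁)
    (hpot : ∫⁻ ζ, ENNReal.ofReal (‖ζ‖ ^ (-(γ * q.toReal))) ∂μ ≠ ⊤) :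
    ∃ ψ : E → Lp ℂ p μ →L[ℂ] ℂ,
      (∀ z (f : Lp ℂ p μ),
        Integrable (fun ζ => f ζ * ((‖z‖ ^ γ * ‖ζ‖ ^ (-γ) * max ‖ζ - z‖ δ ^ (-t) : ℝ) : ℂ)) μ ∧
        ψ z f = ∫ ζ, f ζ * ((‖z‖ ^ γ * ‖ζ‖ ^ (-γ) * max ‖ζ - z‖ δ ^ (-t) : ℝ) : ℂ) ∂μ) ∧
      ∀ ε > 0, ∃ s : Finset E, ∀ z, ‖z‖ ≤ R₁ → ∃ w ∈ s, ‖ψ z - ψ w‖ ≤ ε := by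
  have := ENNReal.HolderConjugate.of_toReal hpq
  have hq1 : Fact (1 ≤ q) := ⟨ENNReal.HolderConjugate.one_le q p⟩
  have hQ := hpq.symm.pos
  obtain ⟨hq0, hqt⟩ := ENNReal.toReal_pos_iff.1 hQ
  set G : E → E → ℝ := fun ζ z => ‖z‖ ^ γ * max ‖ζ - z‖ δ ^ (-t) with hG
  have hGc : Continuous (Function.uncurry G) := by
    refine (Continuous.rpow_const continuous_snd.norm fun _ => Or.inr hγ).mul
      (Continuous.rpow_const ((continuous_fst.sub continuous_snd).norm.max continuous_const)
        fun x => Or.inl (hδ.trans_le (le_max_right _ _)).ne')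
  have hGz : ∀ z, Continuous fun ζ => G ζ z := fun z => hGc.comp (Continuous.prodMk_left z)
  have hGb : ∀ ζ z, ‖G ζ z‖ ≤ ‖z‖ ^ γ * δ ^ (-t) := by
    intro ζ z
    have : 0 < max ‖ζ - z‖ δ := hδ.trans_le (le_max_right _ _)
    rw [Real.norm_of_nonneg (by positivity)]
    exact mul_le_mul_of_nonneg_left
      (Real.rpow_le_rpow_of_nonpos hδ (le_max_right _ _) (by linarith)) (by positivity)
  have hgm : Measurable fun ζ : E => ‖ζ‖ ^ (-γ) := continuous_norm.measurable.pow_const _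
  have hg : MemLp (fun ζ : E => ‖ζ‖ ^ (-γ)) q μ := by
    refine ⟨hgm.aestronglyMeasurable, ?_⟩
    rw [eLpNorm_lt_top_iff_lintegral_rpow_enorm_lt_top hq0.ne' hqt.ne]
    refine lt_of_eq_of_lt (lintegral_congr fun ζ => ?_) hpot.lt_top
    rw [Real.enorm_of_nonneg (by positivity), ENNReal.ofReal_rpow_of_nonneg (by positivity) hQ.le,
      ← Real.rpow_mul (norm_nonneg _), neg_mul]
  have hk : ∀ z, MemLp (fun ζ => ((‖z‖ ^ γ * ‖ζ‖ ^ (-γ) * max ‖ζ - z‖ δ ^ (-t) : ℝ) : ℂ)) q μ := by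
    intro z
    refine MemLp.of_le_mul (c := ‖z‖ ^ γ * δ ^ (-t)) hg ?_ ?_
    · refine (Complex.measurable_ofReal.comp ?_).aestronglyMeasurable
      have : Measurable fun ζ => G ζ z * ‖ζ‖ ^ (-γ) := (hGz z).measurable.mul hgm
      convert this using 2
      simp only [hG]; ring
    · refine Filter.Eventually.of_forall fun ζ => ?_
      rw [Complex.norm_real, show ‖z‖ ^ γ * ‖ζ‖ ^ (-γ) * max ‖ζ - z‖ δ ^ (-t) =
        G ζ z * ‖ζ‖ ^ (-γ) by simp only [hG]; ring, norm_mul]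
      gcongr
      exact hGb ζ z
  set Λ : Lp ℂ q μ →L[ℂ] Lp ℂ p μ →L[ℂ] ℂ :=
    (ContinuousLinearMap.lpPairing μ p q (ContinuousLinearMap.mul ℂ ℂ)).flip with hΛ
  refine ⟨fun z => Λ (hk z).toLp, fun z f => ⟨?_, ?_⟩, fun ε hε => ?_⟩
  · exact MemLp.integrable_mul (Lp.memLp f) (hk z)
  · rw [hΛ, ContinuousLinearMap.flip_apply, ContinuousLinearMap.lpPairing_eq_integral]
    refine integral_congr_ae ?_
    filter_upwards [(hk z).coeFn_toLp] with ζ hζ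
    rw [hζ, ContinuousLinearMap.mul_apply']
  · set M : ℝ := ‖Λ‖ * ‖hg.toLp‖ + 1 with hM
    have hM0 : 0 < M := by positivity
    have huc := (((isCompact_closedBall (0 : E) R₁).prod
      (isCompact_closedBall (0 : E) R₁)).uniformContinuousOn_of_continuous hGc.continuousOn)
    obtain ⟨ρ, hρ, hρ'⟩ := Metric.uniformContinuousOn_iff.1 huc (ε / M) (by positivity)
    obtain ⟨s, hsB, hsf, hs⟩ := finite_approx_of_totallyBounded
      (isCompact_closedBall (0 : E) R₁).totallyBounded ρ hρ
    refine ⟨hsf.toFinset, fun z hz => ?_⟩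
    have hzB : z ∈ closedBall (0 : E) R₁ := by simpa using hz
    obtain ⟨w, hw, hzw⟩ : ∃ w, w ∈ s ∧ z ∈ ball w ρ := by simpa using hs hzB
    refine ⟨w, by simpa using hw, ?_⟩
    rw [← map_sub, ← MemLp.toLp_sub]
    refine (Λ.le_opNorm _).trans ?_
    have hn : ‖((hk z).sub (hk w)).toLp‖ ≤ ε / M * ‖hg.toLp‖ := by
      refine Lp.norm_le_mul_norm_of_ae_le_mul ?_
      filter_upwards [((hk z).sub (hk w)).coeFn_toLp, hg.coeFn_toLp, hsupp] with ζ h1 h2 h3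
      have h4 := hρ' (ζ, z) ⟨by simpa using h3, hzB⟩ (ζ, w) ⟨by simpa using h3, hsB hw⟩
        (by simpa [Prod.dist_eq] using hzw)
      rw [h1, h2, Pi.sub_apply, ← Complex.ofReal_sub, Complex.norm_real,
        show ‖z‖ ^ γ * ‖ζ‖ ^ (-γ) * max ‖ζ - z‖ δ ^ (-t) -
          ‖w‖ ^ γ * ‖ζ‖ ^ (-γ) * max ‖ζ - w‖ δ ^ (-t) = (G ζ z - G ζ w) * ‖ζ‖ ^ (-γ) by
            simp only [hG]; ring, norm_mul]
      gcongr
      rw [Real.dist_eq] at h4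
      exact h4.le
    calc ‖Λ‖ * ‖((hk z).sub (hk w)).toLp‖ ≤ ‖Λ‖ * (ε / M * ‖hg.toLp‖) := by gcongr
      _ = ε * ((‖Λ‖ * ‖hg.toLp‖) / M) := by ring
      _ ≤ ε * 1 := by
        gcongr
        rw [div_le_one hM0, hM]
        linarith
      _ = ε := mul_one ε

theorem abs_rpow_neg_sub_max_rpow_neg_le {x δ : ℝ} (hx : 0 < x) (hδ : 0 < δ) {t : ℝ}
    (ht : 0 ≤ t) : |x ^ (-t) - max x δ ^ (-t)| ≤ δ ^ (1 / 2 : ℝ) * x ^ (-(t + 1 / 2)) := by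
  rcases le_total δ x with h | h
  · rw [max_eq_left h, sub_self, abs_zero]; positivity
  · rw [max_eq_right h]
    have h1 : δ ^ (-t) ≤ x ^ (-t) := Real.rpow_le_rpow_of_nonpos hx h (by linarith)
    have h2 : 0 ≤ δ ^ (-t) := by positivity
    rw [abs_of_nonneg (by linarith)]
    calc x ^ (-t) - δ ^ (-t) ≤ x ^ (-t) := by linarith
      _ = x ^ (1 / 2 : ℝ) * x ^ (-(t + 1 / 2)) := by rw [← Real.rpow_add hx]; congr 1; ring
      _ ≤ _ := by gcongr

theorem isCompact_closure_image_ball_weightedKernel {E : Type*} [NormedAddCommGroup E]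
    [ProperSpace E] [SecondCountableTopology E] [MeasurableSpace E] [BorelSpace E] (μ : Measure E)
    [IsFiniteMeasure μ] [NullSingletonClass μ] {R₁ γ t : ℝ} {p q : ℝ≥0∞} [Fact (1 ≤ p)]
    (hpq : p.toReal.HolderConjugate q.toReal) (hγ : 0 ≤ γ) (ht : 0 ≤ t)
    (hsupp : ∀ᵐ ζ ∂μ, ‖ζ‖ ≤ R₁)
    (hpot : ∀ r : ℝ, r = γ * q.toReal ∨ r = t + 1 / 2 → ∃ M : ℝ≥0∞, M ≠ ⊤ ∧
      ∀ w : E, ∫⁻ ζ, ENNReal.ofReal (‖ζ - w‖ ^ (-r)) ∂μ ≤ M)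
    (T : Lp ℂ p μ →L[ℂ] Lp ℂ p μ)
    (hT : ∀ f : Lp ℂ p μ, ∀ᵐ z ∂μ, T f z = ∫ ζ, f ζ * (weightedKernel γ t ζ z : ℂ) ∂μ) :
    IsCompact (closure (T '' ball 0 1)) := by
  have hp1 : 1 ≤ p := Fact.out
  obtain ⟨C, hC, hCf⟩ := exists_eLpNorm_lintegral_weightedKernel_le μ hpq hγ hsupp hpot
  have hpot0 : ∫⁻ ζ, ENNReal.ofReal (‖ζ‖ ^ (-(γ * q.toReal))) ∂μ ≠ ⊤ := by
    obtain ⟨M, hM, h⟩ := hpot _ (Or.inl rfl)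
    have := h 0
    simp only [sub_zero] at this
    exact (this.trans_lt hM.lt_top).ne
  set V : ℝ≥0∞ := μ Set.univ ^ p.toReal⁻¹ with hV
  have hVt : V ≠ ⊤ := by
    have := hpq.pos
    rw [hV]; finiteness
  refine isCompact_closure_image_ball_of_norm_le (ι := E) T fun ε hε => ?_
  set c : ℝ := ε / (2 * (C.toReal + 1)) with hc
  have hc0 : 0 < c := by positivity
  set ε' : ℝ := ε / (2 * (V.toReal + 1)) with hε'
  have hε'0 : 0 < ε' := by positivity
  have hsq : (c ^ 2) ^ (1 / 2 : ℝ) = c := by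
    rw [← Real.sqrt_eq_rpow, Real.sqrt_sq hc0.le]
  obtain ⟨ψ, hψ, happ⟩ := exists_finset_dual_truncatedKernel μ (δ := c ^ 2) hpq hγ ht
    (by positivity) hsupp hpot0
  obtain ⟨s, hs⟩ := happ ε' hε'0
  refine ⟨s, ψ, V.toReal, ENNReal.toReal_nonneg, fun f => ?_⟩
  set S : E → ℝ≥0∞ := fun z =>
    ∫⁻ ζ, ‖f ζ‖ₑ * ENNReal.ofReal (weightedKernel γ (t + 1 / 2) ζ z) ∂μ with hS
  have hSm : Measurable S := by
    have : Measurable fun x : E × E => ‖f x.2‖ₑ *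
        ENNReal.ofReal (weightedKernel γ (t + 1 / 2) x.2 x.1) :=
      ((Lp.stronglyMeasurable f).enorm.comp measurable_snd).mul
        ((measurable_weightedKernel γ (t + 1 / 2)).comp measurable_swap).ennreal_ofReal
    exact this.lintegral_prod_right'
  set b : ℝ := ε' * ‖f‖ + ∑ w ∈ s, ‖ψ w f‖ with hb
  have hb0 : 0 ≤ b := by positivity
  have hfar : ∀ z, ‖z‖ ≤ R₁ → ‖ψ z f‖ ≤ b := by
    intro z hz
    obtain ⟨w, hw, hzw⟩ := hs z hz
    have h1 : ‖ψ z f - ψ w f‖ ≤ ε' * ‖f‖ := by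
      rw [← sub_apply]
      exact (ContinuousLinearMap.le_opNorm _ _).trans (by gcongr)
    have h2 : ‖ψ w f‖ ≤ ∑ w ∈ s, ‖ψ w f‖ :=
      Finset.single_le_sum (f := fun w => ‖ψ w f‖) (fun _ _ => norm_nonneg _) hw
    linarith [norm_le_norm_sub_add (ψ z f) (ψ w f)]
  have hpt : ∀ᵐ z ∂μ, ‖T f z‖ₑ ≤
      ‖((fun z => ENNReal.ofReal c * S z) + (fun _ => ENNReal.ofReal b) : E → ℝ≥0∞) z‖ₑ := by
    filter_upwards [hT f, hsupp] with z hz hzR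
    rw [enorm_eq_self, Pi.add_apply, hz]
    by_cases hi : Integrable (fun ζ => f ζ * (weightedKernel γ t ζ z : ℂ)) μ
    swap
    · rw [integral_undef hi, enorm_zero]; exact zero_le
    obtain ⟨hi', hψz⟩ := hψ z f
    have hsplit : ∫ ζ, f ζ * (weightedKernel γ t ζ z : ℂ) ∂μ =
        ∫ ζ, (f ζ * (weightedKernel γ t ζ z : ℂ) - f ζ *
          ((‖z‖ ^ γ * ‖ζ‖ ^ (-γ) * max ‖ζ - z‖ (c ^ 2) ^ (-t) : ℝ) : ℂ)) ∂μ + ψ z f := by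
      rw [integral_sub hi hi', hψz, sub_add_cancel]
    rw [hsplit]
    refine (enorm_add_le _ _).trans (add_le_add ?_ ?_)
    · refine (enorm_integral_le_lintegral_enorm _).trans ?_
      rw [hS, ← lintegral_const_mul' _ _ ENNReal.ofReal_ne_top]
      have hne : ∀ᵐ ζ ∂μ, ζ ≠ z := by simp [ae_iff]
      refine lintegral_mono_ae (hne.mono fun ζ hζ => ?_)
      have hx : 0 < ‖ζ - z‖ := norm_pos_iff.2 (sub_ne_zero.2 hζ)
      rw [← mul_sub, enorm_mul, mul_left_comm, ← ENNReal.ofReal_mul hc0.le, ← Complex.ofReal_sub]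
      gcongr
      rw [← ofReal_norm, Complex.norm_real]
      refine ENNReal.ofReal_le_ofReal ?_
      have h1 := abs_rpow_neg_sub_max_rpow_neg_le hx (by positivity : 0 < c ^ 2) ht
      rw [hsq] at h1
      unfold weightedKernel
      rw [← mul_sub, norm_mul, Real.norm_of_nonneg (by positivity), Real.norm_eq_abs]
      calc _ ≤ ‖z‖ ^ γ * ‖ζ‖ ^ (-γ) * (c * ‖ζ - z‖ ^ (-(t + 1 / 2))) := by gcongr
        _ = _ := by ring
    · rw [← ofReal_norm]
      exact ENNReal.ofReal_le_ofReal (hfar z hzR)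
  have hnorm : ‖T f‖ₑ ≤ ENNReal.ofReal c * (C * ‖f‖ₑ) + ENNReal.ofReal b * V := by
    rw [Lp.enorm_def]
    refine (eLpNorm_mono_enorm_ae hpt).trans ((eLpNorm_add_le
      (hSm.const_mul _).aestronglyMeasurable aestronglyMeasurable_const hp1).trans ?_)
    gcongr
    · have hCS := hCf f
      have hp0 : p ≠ 0 := (one_pos.trans_le hp1).ne'
      have hpt : p ≠ ⊤ := (ENNReal.toReal_pos_iff.1 hpq.pos).2.ne
      have hP := hpq.pos
      rw [eLpNorm_eq_lintegral_rpow_enorm_toReal hp0 hpt] at hCS ⊢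
      simp only [enorm_eq_self, ENNReal.mul_rpow_of_nonneg _ _ hP.le] at hCS ⊢
      rw [lintegral_const_mul' _ _ (by finiteness), ENNReal.mul_rpow_of_nonneg _ _ (by positivity),
        ← ENNReal.rpow_mul, mul_one_div_cancel hP.ne', ENNReal.rpow_one]
      gcongr
    · simpa using eLpNorm_le_of_ae_enorm_bound (p := p) (μ := μ)
        (f := fun _ : E => ENNReal.ofReal b) (C := ENNReal.ofReal b) (by simp)
  have hreal : ‖T f‖ ≤ c * (C.toReal * ‖f‖) + b * V.toReal := by
    have h1 := ENNReal.toReal_mono (by finiteness) hnorm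
    rw [ENNReal.toReal_add (by finiteness) (by finiteness)] at h1
    simpa [ENNReal.toReal_mul, ENNReal.toReal_ofReal hc0.le, ENNReal.toReal_ofReal hb0] using h1
  have e1 : c * (2 * (C.toReal + 1)) = ε := div_mul_cancel₀ _ (by positivity)
  have e2 : ε' * (2 * (V.toReal + 1)) = ε := div_mul_cancel₀ _ (by positivity)
  have e3 : c * C.toReal + ε' * V.toReal ≤ ε := by linarith
  calc ‖T f‖ ≤ c * (C.toReal * ‖f‖) + b * V.toReal := hreal
    _ = (c * C.toReal + ε' * V.toReal) * ‖f‖ + V.toReal * ∑ w ∈ s, ‖ψ w f‖ := by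
      rw [hb]; ring
    _ ≤ _ := by gcongr

theorem nullSingletonClass_of_measure_ball_le {E : Type*} [NormedAddCommGroup E]
    [MeasurableSpace E] (μ : Measure E) {C₀ R d : ℝ} (hR : 0 < R) (hd : 0 < d)
    (hμ : ∀ (w : E) (ρ : ℝ), 0 < ρ → ρ ≤ R → μ (ball w ρ) ≤ ENNReal.ofReal (C₀ * ρ ^ d)) :
    NullSingletonClass μ := by
  refine ⟨fun w => le_antisymm ?_ zero_le⟩
  have hlim : Filter.Tendsto (fun ρ : ℝ => ENNReal.ofReal (C₀ * ρ ^ d))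
      (nhdsWithin 0 (Set.Ioi 0)) (nhds 0) := by
    have h1 : Continuous fun ρ : ℝ => ENNReal.ofReal (C₀ * ρ ^ d) :=
      ENNReal.continuous_ofReal.comp
        (continuous_const.mul (Real.continuous_rpow_const hd.le))
    have h2 := h1.tendsto 0
    simp only [Real.zero_rpow hd.ne', mul_zero, ENNReal.ofReal_zero] at h2
    exact h2.mono_left nhdsWithin_le_nhds
  refine ge_of_tendsto hlim ?_
  filter_upwards [Ioc_mem_nhdsGT hR] with ρ hρ
  refine (measure_mono ?_).trans (hμ w ρ hρ.1 hρ.2)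
  simpa using hρ.1

/-- Compactness of the Koppelman-type integral operator with kernel
`k_γ(ζ,z) = ‖z‖^γ/(‖ζ‖^γ ‖ζ-z‖^{2n-1})` on `L^p(μ)` for `2n/(2n-γ) < p < ∞`:
there is a bounded linear operator `T` on `L^p(μ)`, given a.e. by integration against
`k_γ`, whose image of the unit ball is relatively compact. -/
theorem koppelman_kernel_Lp_compact
    (n N : ℕ) (hn : 1 ≤ n) (hN : 1 ≤ N)
    [MeasurableSpace (EuclideanSpace ℂ (Fin N))] [BorelSpace (EuclideanSpace ℂ (Fin N))]
    (μ : Measure (EuclideanSpace ℂ (Fin N))) [IsFiniteMeasure μ]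
    (R₁ : ℝ) (hsupp : μ ((closedBall (0 : EuclideanSpace ℂ (Fin N)) R₁)ᶜ) = 0)
    (C₀ R : ℝ) (hC₀ : 0 < C₀) (hR : 0 < R)
    (hAhlfors : ∀ (w : EuclideanSpace ℂ (Fin N)) (ρ : ℝ), 0 < ρ → ρ ≤ R →
      μ (ball w ρ) ≤ ENNReal.ofReal (C₀ * ρ ^ (2 * n)))
    (γ : ℝ) (hγ : 0 ≤ γ) (hγ' : γ < 2 * n)
    (p : ℝ≥0∞) [Fact (1 ≤ p)]
    (hp : ENNReal.ofReal (2 * n / (2 * n - γ)) < p) (hp' : p ≠ ⊤) :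
    ∃ T : Lp ℂ p μ →L[ℂ] Lp ℂ p μ,
      (∀ f : Lp ℂ p μ, ∀ᵐ z ∂μ,
        T f z = ∫ ζ, f ζ * ((‖z‖ ^ γ / (‖ζ‖ ^ γ * ‖ζ - z‖ ^ (2 * n - 1)) : ℝ) : ℂ) ∂μ) ∧
      IsCompact (closure (⇑T '' Metric.ball 0 1)) := by
  have hn' : (1 : ℝ) ≤ n := by exact_mod_cast hn
  have hd : ∀ (w : EuclideanSpace ℂ (Fin N)) (ρ : ℝ), 0 < ρ → ρ ≤ R →
      μ (ball w ρ) ≤ ENNReal.ofReal (C₀ * ρ ^ (2 * n : ℝ)) := by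
    intro w ρ h0 h1
    have := hAhlfors w ρ h0 h1
    rwa [← Real.rpow_natCast, Nat.cast_mul, Nat.cast_ofNat] at this
  have : NullSingletonClass μ := nullSingletonClass_of_measure_ball_le μ hR (by positivity) hd
  have hsupp' : ∀ᵐ ζ ∂μ, ‖ζ‖ ≤ R₁ := by
    filter_upwards [compl_mem_ae_iff.2 hsupp] with ζ hζ
    simpa using hζ
  have hpR : 2 * n / (2 * n - γ) < p.toReal :=
    (ENNReal.ofReal_lt_iff_lt_toReal (div_nonneg (by positivity) (by linarith)) hp').1 hp
  have hP : 1 < p.toReal := by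
    refine lt_of_le_of_lt ?_ hpR
    rw [le_div_iff₀ (by linarith)]
    linarith
  have hconj := Real.HolderConjugate.conjExponent hP
  obtain ⟨q, hq⟩ : ∃ q : ℝ≥0∞, q.toReal = p.toReal.conjExponent :=
    ⟨_, ENNReal.toReal_ofReal hconj.symm.pos.le⟩
  rw [← hq] at hconj
  have hγq : γ * q.toReal < 2 * n := by
    rw [hq, Real.conjExponent, ← mul_div_assoc, div_lt_iff₀ (by linarith)]
    rw [div_lt_iff₀ (by linarith)] at hpR
    linarith
  have hγq0 : 0 ≤ γ * q.toReal := by positivity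
  have hpot : ∀ r : ℝ, 0 ≤ r → r < 2 * n → ∃ M : ℝ≥0∞, M ≠ ⊤ ∧
      ∀ w : EuclideanSpace ℂ (Fin N), ∫⁻ ζ, ENNReal.ofReal (‖ζ - w‖ ^ (-r)) ∂μ ≤ M :=
    fun r h0 h1 => exists_lintegral_norm_sub_rpow_neg_le μ hC₀.le hR hd h0 h1
  have hm : ((2 * n - 1 : ℕ) : ℝ) = 2 * n - 1 := by
    rw [Nat.cast_sub (by omega)]; push_cast; ring
  set t : ℝ := ((2 * n - 1 : ℕ) : ℝ) with ht
  have ht0 : 0 ≤ t := Nat.cast_nonneg _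
  have hker : ∀ ζ z : EuclideanSpace ℂ (Fin N),
      ‖z‖ ^ γ / (‖ζ‖ ^ γ * ‖ζ - z‖ ^ (2 * n - 1)) = weightedKernel γ t ζ z := by
    intro ζ z
    rw [weightedKernel, Real.rpow_neg (norm_nonneg _), Real.rpow_neg (norm_nonneg _), ht,
      Real.rpow_natCast, div_eq_mul_inv, mul_inv, mul_assoc]
  simp only [hker]
  obtain ⟨C, hC, hCf⟩ := exists_eLpNorm_lintegral_weightedKernel_le μ (t := t) hconj hγ hsupp' (by
    rintro r (rfl | rfl)
    · exact hpot _ hγq0 hγq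
    · exact hpot _ ht0 (by linarith))
  obtain ⟨T, hT⟩ := exists_continuousLinearMap_integral_kernel μ hp'
    (fun ζ z => (weightedKernel γ t ζ z : ℂ))
    (Complex.measurable_ofReal.comp (measurable_weightedKernel γ t)) hC (fun f => by
      simpa only [← ofReal_norm, Complex.norm_real,
        Real.norm_of_nonneg (weightedKernel_nonneg γ t _ _)] using hCf f)
  refine ⟨T, hT, isCompact_closure_image_ball_weightedKernel μ hconj hγ ht0 hsupp' ?_ T hT⟩
  rintro r (rfl | rfl)
  · exact hpot _ hγq0 hγq
  · exact hpot _ (by linarith) (by linarith)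
end

section
/- Let N ≥ 1 be an integer. There exists a constant C > 0 such that for every integer k ≥ 1 there is a C^∞ function μ_k : ℂ^N → ℝ (smooth as a function on ℝ^{2N}) with: (i) 0 ≤ μ_k(ζ) ≤ 1 for all ζ; (ii) μ_k(ζ) = 0 whenever ‖ζ‖ ≤ exp(−e^{k+1}); (iii) μ_k(ζ) = 1 whenever ‖ζ‖ ≥ exp(−e^k); and (iv) the (Fréchet) derivative of μ_k satisfies ‖Dμ_k(ζ)‖ ≤ C / ( ‖ζ‖ · |log ‖ζ‖| ) for every ζ with 0 < ‖ζ‖ < 1, with the constant C independent of k. -/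
open Metric

lemma Real.exists_abs_deriv_smoothTransition_le :
    ∃ M : ℝ, 0 < M ∧ ∀ x, |deriv Real.smoothTransition x| ≤ M := by
  have hc : Continuous (deriv Real.smoothTransition) :=
    (Real.smoothTransition.contDiff (n := 1)).continuous_deriv le_rfl
  obtain ⟨M, hM⟩ := (isCompact_Icc (a := (0 : ℝ)) (b := 1)).exists_bound_of_continuousOn
    hc.continuousOn
  refine ⟨max M 1, by positivity, fun x => ?_⟩
  rcases lt_or_ge x 0 with hx | hx
  · have h : Real.smoothTransition =ᶠ[nhds x] fun _ => 0 := by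
      filter_upwards [Iio_mem_nhds hx] with y hy
      exact Real.smoothTransition.zero_of_nonpos (le_of_lt hy)
    rw [h.deriv_eq]
    simp
  rcases lt_or_ge 1 x with hx1 | hx1
  · have h : Real.smoothTransition =ᶠ[nhds x] fun _ => 1 := by
      filter_upwards [Ioi_mem_nhds hx1] with y hy
      exact Real.smoothTransition.one_of_one_le (le_of_lt hy)
    rw [h.deriv_eq]
    simp
  · exact (hM x ⟨hx, hx1⟩).trans (le_max_left _ _)

/-- The logarithmic cut-off profile on the interval `(0, 1)`. -/
noncomputable def logCutoff (c t : ℝ) : ℝ :=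
  Real.smoothTransition (c + 1 - Real.log (-Real.log t))

lemma logCutoff_eq_zero {c t : ℝ} (ht : 0 < t) (h : t ≤ Real.exp (-Real.exp (c + 1))) :
    logCutoff c t = 0 := by
  have h1 : Real.exp (c + 1) ≤ -Real.log t := by
    linarith [(Real.log_le_iff_le_exp ht).2 h]
  have h2 := (Real.le_log_iff_exp_le ((Real.exp_pos _).trans_le h1)).2 h1
  exact Real.smoothTransition.zero_of_nonpos (by linarith)

lemma logCutoff_eq_one {c t : ℝ} (ht : t < 1) (h : Real.exp (-Real.exp c) ≤ t) :
    logCutoff c t = 1 := by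
  have h0 : 0 < t := (Real.exp_pos _).trans_le h
  have hl := Real.log_neg h0 ht
  have h1 : -Real.log t ≤ Real.exp c := by
    linarith [(Real.le_log_iff_exp_le h0).2 h]
  have h2 := (Real.log_le_iff_le_exp (neg_pos.2 hl)).2 h1
  exact Real.smoothTransition.one_of_one_le (by linarith)

lemma contDiffAt_logCutoff {c t : ℝ} (h0 : 0 < t) (h1 : t < 1) {n : ℕ∞} :
    ContDiffAt ℝ n (logCutoff c) t :=
  Real.smoothTransition.contDiff.contDiffAt.comp t <| contDiffAt_const.sub <|
    (contDiffAt_id.log h0.ne').neg.log (neg_pos.2 (Real.log_neg h0 h1)).ne'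

lemma hasDerivAt_logCutoff {c t : ℝ} (h0 : 0 < t) (h1 : t < 1) :
    HasDerivAt (logCutoff c) (deriv Real.smoothTransition (c + 1 - Real.log (-Real.log t)) *
      -(-t⁻¹ / -Real.log t)) t := by
  have hl := (neg_pos.2 (Real.log_neg h0 h1)).ne'
  have hS : HasDerivAt Real.smoothTransition _ (c + 1 - Real.log (-Real.log t)) :=
    ((Real.smoothTransition.contDiff (n := 1)).differentiable one_ne_zero _).hasDerivAt
  exact hS.comp t (((Real.hasDerivAt_log h0.ne').neg.log hl).const_sub _)

/-- Existence of the logarithmic cut-off functions `μ_k`, smooth on `ℂ^N ≅ ℝ^{2N}`,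
vanishing on `{‖ζ‖ ≤ exp(−e^{k+1})}`, equal to `1` on `{‖ζ‖ ≥ exp(−e^k)}`, and with
derivative bounded by `C/(‖ζ‖ |log ‖ζ‖|)` uniformly in `k`. -/
theorem exists_log_cutoff_functions (N : ℕ) (hN : 1 ≤ N) :
    ∃ C : ℝ, 0 < C ∧
      ∀ k : ℕ, 1 ≤ k →
        ∃ μk : EuclideanSpace ℂ (Fin N) → ℝ,
          ContDiff ℝ (⊤ : ℕ∞) μk ∧
          (∀ ζ, 0 ≤ μk ζ ∧ μk ζ ≤ 1) ∧
          (∀ ζ, ‖ζ‖ ≤ Real.exp (-Real.exp (k + 1)) → μk ζ = 0) ∧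
          (∀ ζ, Real.exp (-Real.exp k) ≤ ‖ζ‖ → μk ζ = 1) ∧
          (∀ ζ : EuclideanSpace ℂ (Fin N), 0 < ‖ζ‖ → ‖ζ‖ < 1 →
            ‖fderiv ℝ μk ζ‖ ≤ C / (‖ζ‖ * |Real.log ‖ζ‖|)) := by
  obtain ⟨M, hM0, hM⟩ := Real.exists_abs_deriv_smoothTransition_le
  refine ⟨M, hM0, fun k _ => ?_⟩
  have ha : 0 < Real.exp (-Real.exp ((k : ℝ) + 1)) := Real.exp_pos _
  have hab : Real.exp (-Real.exp ((k : ℝ) + 1)) < Real.exp (-Real.exp k) := by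
    simp
  have hb : Real.exp (-Real.exp (k : ℝ)) < 1 := by
    simp [Real.exp_pos]
  let μ : EuclideanSpace ℂ (Fin N) → ℝ := fun ζ =>
    if ‖ζ‖ ≤ Real.exp (-Real.exp ((k : ℝ) + 1)) then 0
    else if Real.exp (-Real.exp (k : ℝ)) ≤ ‖ζ‖ then 1
    else logCutoff k ‖ζ‖
  have hzero : ∀ ζ, ‖ζ‖ ≤ Real.exp (-Real.exp ((k : ℝ) + 1)) → μ ζ = 0 :=
    fun ζ h => if_pos h
  have hone : ∀ ζ, Real.exp (-Real.exp (k : ℝ)) ≤ ‖ζ‖ → μ ζ = 1 :=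
    fun ζ h => (if_neg (hab.trans_le h).not_ge).trans (if_pos h)
  have hmid : ∀ ζ, 0 < ‖ζ‖ → ‖ζ‖ < 1 → μ ζ = logCutoff k ‖ζ‖ := by
    intro ζ h0 h1
    by_cases h : ‖ζ‖ ≤ Real.exp (-Real.exp ((k : ℝ) + 1))
    · rw [hzero ζ h, logCutoff_eq_zero h0 h]
    by_cases h' : Real.exp (-Real.exp (k : ℝ)) ≤ ‖ζ‖
    · rw [hone ζ h', logCutoff_eq_one h1 h']
    exact (if_neg h).trans (if_neg h')
  have hev : ∀ ζ, 0 < ‖ζ‖ → ‖ζ‖ < 1 → μ =ᶠ[nhds ζ] fun z => logCutoff k ‖z‖ := by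
    intro ζ h0 h1
    filter_upwards [continuous_norm.continuousAt.eventually (Ioo_mem_nhds h0 h1)] with z hz
    exact hmid z hz.1 hz.2
  refine ⟨μ, ?_, ?_, hzero, hone, ?_⟩
  · refine contDiff_iff_contDiffAt.2 fun ζ => ?_
    rcases lt_or_ge ‖ζ‖ (Real.exp (-Real.exp ((k : ℝ) + 1))) with h | h
    · refine (contDiffAt_const (c := (0 : ℝ))).congr_of_eventuallyEq ?_
      filter_upwards [continuous_norm.continuousAt.eventually (Iio_mem_nhds h)] with z hz
      exact hzero z (le_of_lt hz)
    rcases lt_or_ge ‖ζ‖ 1 with h1 | h1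
    · have h0 : 0 < ‖ζ‖ := ha.trans_le h
      exact ((contDiffAt_logCutoff h0 h1).comp ζ
        (contDiffAt_norm ℂ (norm_pos_iff.1 h0))).congr_of_eventuallyEq (hev ζ h0 h1)
    · refine (contDiffAt_const (c := (1 : ℝ))).congr_of_eventuallyEq ?_
      filter_upwards [continuous_norm.continuousAt.eventually
        (Ioi_mem_nhds (hb.trans_le h1))] with z hz
      exact hone z (le_of_lt hz)
  · intro ζ
    simp only [μ]
    split_ifs
    · simp
    · simp
    · exact ⟨Real.smoothTransition.nonneg _, Real.smoothTransition.le_one _⟩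
  · intro ζ h0 h1
    have hn : HasFDerivAt (fun z : EuclideanSpace ℂ (Fin N) => ‖z‖) _ ζ :=
      ((contDiffAt_norm ℂ (n := 1) (norm_pos_iff.1 h0)).differentiableAt
        one_ne_zero).hasFDerivAt
    have hd := (hasDerivAt_logCutoff (c := k) h0 h1).comp_hasFDerivAt ζ hn
    have hL : ‖fderiv ℝ (fun z : EuclideanSpace ℂ (Fin N) => ‖z‖) ζ‖ ≤ 1 := by
      simpa using norm_fderiv_le_of_lipschitz ℝ
        (lipschitzWith_one_norm (E := EuclideanSpace ℂ (Fin N))) (x₀ := ζ)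
    rw [(hd.congr_of_eventuallyEq (hev ζ h0 h1)).fderiv, norm_smul, Real.norm_eq_abs, abs_mul]
    have he : |-(-‖ζ‖⁻¹ / -Real.log ‖ζ‖)| = 1 / (‖ζ‖ * |Real.log ‖ζ‖|) := by
      rw [abs_neg, abs_div, abs_neg, abs_neg, abs_inv, abs_norm]
      field_simp
    rw [he, div_eq_mul_one_div M]
    exact (mul_le_of_le_one_right (by positivity) hL).trans
      (mul_le_mul_of_nonneg_right (hM _) (by positivity))
end
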